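/- Assume either (N = 2, 2 < p < 4 and 2ks ≤ 6 − p) or (N = 3, 2 < p < 10/3 and ks ≤ 4 − p). Then for every c ∈ (0, +∞) there exist λ > −λ₁(B) and a positive solution u of (P_λ) with ∫_B u² dx = c. -/

import Mathlib

open MeasureTheory Set Filter Topology

noncomputable section

/-- `N`-dimensional Euclidean space. -/
abbrev Euc (N : ℕ) := EuclideanSpace ℝ (Fin N)

/-- The Laplacian of a real-valued function on Euclidean space, defined as the
sum of the pure second partial derivatives in the coordinate directions. -/
def lap {N : ℕ} (u : Euc N → ℝ) (x : Euc N) : ℝ :=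
  ∑ i : Fin N,
    fderiv ℝ (fun y => fderiv ℝ u y (EuclideanSpace.single i 1)) x (EuclideanSpace.single i 1)

/-- The first Dirichlet eigenvalue of `-Δ` on `Ω`, defined as the infimum of
Rayleigh quotients of nonzero smooth functions with compact support contained in `Ω`. -/
def firstEig {N : ℕ} (Ω : Set (Euc N)) : ℝ :=
  sInf { r : ℝ | ∃ φ : Euc N → ℝ, ContDiff ℝ (⊤ : ℕ∞) φ ∧ HasCompactSupport φ ∧
    tsupport φ ⊆ Ω ∧ φ ≠ 0 ∧
    r = (∫ x, ‖fderiv ℝ φ x‖ ^ 2) / (∫ x, (φ x) ^ 2) }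

/-- `u` is a (classical) positive solution of `-Δ u + lam • u = f(x, u)` in `Ω`,
vanishing on the boundary: `u ∈ C²(Ω) ∩ C(closure Ω)`, `u > 0` in `Ω`, `u = 0` on `∂Ω`. -/
def IsPosSolution {N : ℕ} (Ω : Set (Euc N)) (f : Euc N → ℝ → ℝ) (lam : ℝ)
    (u : Euc N → ℝ) : Prop :=
  ContDiffOn ℝ 2 u Ω ∧ ContinuousOn u (closure Ω) ∧ (∀ x ∈ Ω, 0 < u x) ∧
    (∀ x ∈ frontier Ω, u x = 0) ∧ ∀ x ∈ Ω, - lap u x + lam * u x = f x (u x)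

/-- The nonlinearity `(1 + |x|^k)^{-s} t^{p-1}` of problem `(P_λ)` on the unit ball. -/
def fker (N : ℕ) (k s p : ℝ) : Euc N → ℝ → ℝ :=
  fun x t => (1 + ‖x‖ ^ k) ^ (-s) * t ^ (p - 1)

section Variational

variable {X H : Type*} [MeasurableSpace X] [NormedAddCommGroup H] [InnerProductSpace ℝ H]

/-- A family of vectors `K x` in a Hilbert space, seen as the reproducing kernel of the functions
`x ↦ ⟪K x, h⟫`, dominated by a weight `W` with integrable power `W ^ (p + 1)`, together with
a bounded potential `V`. -/
structure AdmissibleKernel (ν : Measure X) (K : X → H) (V W : X → ℝ) (p : ℝ) : Prop where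
  two_lt : 2 < p
  meas : ∀ h, AEStronglyMeasurable (fun x => inner ℝ (K x) h) ν
  measV : AEStronglyMeasurable V ν
  nonnegV : ∀ᵐ x ∂ν, 0 ≤ V x
  le_oneV : ∀ᵐ x ∂ν, V x ≤ 1
  norm_le : ∀ᵐ x ∂ν, ‖K x‖ ≤ W x
  one_le : ∀ᵐ x ∂ν, 1 ≤ W x
  integrable_rpow : Integrable (fun x => W x ^ (p + 1)) ν

/-- The mass `∫ u²` of the function `u = ⟪K ·, h⟫`. -/
def mass (ν : Measure X) (K : X → H) (h : H) : ℝ := ∫ x, (inner ℝ (K x) h) ^ 2 ∂ν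

/-- The potential term `∫ V |u|^p` of the function `u = ⟪K ·, h⟫`. -/
def potential (ν : Measure X) (K : X → H) (V : X → ℝ) (p : ℝ) (h : H) : ℝ :=
  ∫ x, V x * |inner ℝ (K x) h| ^ p ∂ν

/-- The energy of the function `u = ⟪K ·, h⟫`. -/
def energy (ν : Measure X) (K : X → H) (V : X → ℝ) (p : ℝ) (h : H) : ℝ :=
  ‖h‖ ^ 2 / 2 - potential ν K V p h / p

namespace AdmissibleKernel

variable {ν : Measure X} {K : X → H} {V W : X → ℝ} {p : ℝ}

lemma abs_inner_le (hK : AdmissibleKernel ν K V W p) (h : H) :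
    ∀ᵐ x ∂ν, |inner ℝ (K x) h| ≤ ‖h‖ * W x := by
  filter_upwards [hK.norm_le] with x hx
  calc |inner ℝ (K x) h| ≤ ‖K x‖ * ‖h‖ := abs_real_inner_le_norm _ _
    _ ≤ ‖h‖ * W x := by rw [mul_comm]; gcongr

lemma integrable_of_le (hK : AdmissibleKernel ν K V W p) {f : X → ℝ}
    (hf : AEStronglyMeasurable f ν) (C : ℝ) {q : ℝ} (hq : q ≤ p + 1)
    (h : ∀ᵐ x ∂ν, |f x| ≤ C * W x ^ q) : Integrable f ν := by
  refine Integrable.mono' (hK.integrable_rpow.const_mul |C|) hf ?_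
  filter_upwards [h, hK.one_le] with x hx hW
  calc ‖f x‖ ≤ C * W x ^ q := hx
    _ ≤ |C| * W x ^ q := by gcongr; exact le_abs_self C
    _ ≤ |C| * W x ^ (p + 1) := by gcongr

lemma abs_inner_rpow_le (hK : AdmissibleKernel ν K V W p) (h : H) {q : ℝ} (hq : 0 ≤ q) :
    ∀ᵐ x ∂ν, |inner ℝ (K x) h| ^ q ≤ ‖h‖ ^ q * W x ^ q := by
  filter_upwards [hK.abs_inner_le h, hK.one_le] with x hx hW
  rw [← Real.mul_rpow (norm_nonneg _) (by linarith)]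
  gcongr

lemma integrable_mul (hK : AdmissibleKernel ν K V W p) (h k : H) :
    Integrable (fun x => inner ℝ (K x) h * inner ℝ (K x) k) ν := by
  have := hK.two_lt
  refine hK.integrable_of_le ((hK.meas h).mul (hK.meas k)) (‖h‖ * ‖k‖) (q := 2) (by linarith) ?_
  filter_upwards [hK.abs_inner_le h, hK.abs_inner_le k, hK.one_le] with x hx hx' hW
  rw [abs_mul, Real.rpow_two]
  calc _ ≤ (‖h‖ * W x) * (‖k‖ * W x) := by gcongr
    _ = _ := by ring

lemma integrable_sq (hK : AdmissibleKernel ν K V W p) (h : H) :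
    Integrable (fun x => (inner ℝ (K x) h) ^ 2) ν := by
  simpa only [sq] using hK.integrable_mul h h

lemma meas_potential (hK : AdmissibleKernel ν K V W p) (h : H) :
    AEStronglyMeasurable (fun x => V x * |inner ℝ (K x) h| ^ p) ν := by
  have := hK.two_lt
  have hc : Continuous (fun t : ℝ => |t| ^ p) :=
    continuous_abs.rpow_const fun _ => Or.inr (by linarith)
  exact hK.measV.mul (hc.comp_aestronglyMeasurable (hK.meas h))

lemma potential_bound (hK : AdmissibleKernel ν K V W p) (h : H) :
    ∀ᵐ x ∂ν, |V x * |inner ℝ (K x) h| ^ p| ≤ ‖h‖ ^ p * W x ^ p := by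
  have := hK.two_lt
  filter_upwards [hK.abs_inner_rpow_le h (q := p) (by linarith), hK.nonnegV, hK.le_oneV]
    with x hx hV hV1
  have h0 : 0 ≤ |inner ℝ (K x) h| ^ p := by positivity
  rw [abs_of_nonneg (by positivity)]
  calc _ ≤ 1 * |inner ℝ (K x) h| ^ p := by gcongr
    _ ≤ _ := by rwa [one_mul]

lemma integrable_potential (hK : AdmissibleKernel ν K V W p) (h : H) :
    Integrable (fun x => V x * |inner ℝ (K x) h| ^ p) ν :=
  hK.integrable_of_le (hK.meas_potential h) _ (by linarith) (hK.potential_bound h)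

lemma mass_smul (c : ℝ) (h : H) : mass ν K (c • h) = c ^ 2 * mass ν K h := by
  simp only [mass, inner_smul_right, mul_pow, integral_const_mul]

lemma potential_smul {c : ℝ} (hc : 0 ≤ c) (h : H) :
    potential ν K V p (c • h) = c ^ p * potential ν K V p h := by
  simp only [potential, inner_smul_right, abs_mul, abs_of_nonneg hc]
  rw [← integral_const_mul]
  congr 1 with x
  rw [Real.mul_rpow hc (abs_nonneg _)]
  ring

lemma mass_add_smul (hK : AdmissibleKernel ν K V W p) (h k : H) (t : ℝ) :
    mass ν K (h + t • k) = mass ν K h + 2 * t * (∫ x, inner ℝ (K x) h * inner ℝ (K x) k ∂ν)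
      + t ^ 2 * mass ν K k := by
  simp only [mass]
  rw [← integral_const_mul, ← integral_const_mul, ← integral_add, ← integral_add]
  · congr 1 with x
    rw [inner_add_right, inner_smul_right]
    ring
  · exact (hK.integrable_sq h).add ((hK.integrable_mul h k).const_mul _)
  · exact (hK.integrable_sq k).const_mul _
  · exact hK.integrable_sq h
  · exact (hK.integrable_mul h k).const_mul _

/-- The potential term grows with a power of the norm less than two, at bounded mass. -/
lemma potential_le (hK : AdmissibleKernel ν K V W p) {σ θ : ℝ} (hp : p = 2 * θ + σ) (hθ : 0 < θ)
    (hθ1 : θ < 1) (hσ : 0 < σ) (hW : Integrable (fun x => W x ^ (σ / (1 - θ))) ν) (h : H) :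
    potential ν K V p h ≤ ‖h‖ ^ σ * (mass ν K h + ∫ x, W x ^ (σ / (1 - θ)) ∂ν) := by
  rw [mass, ← integral_add (hK.integrable_sq h) hW, ← integral_const_mul]
  refine integral_mono_ae (hK.integrable_potential h)
    (((hK.integrable_sq h).add hW).const_mul _) ?_
  filter_upwards [hK.abs_inner_rpow_le h hσ.le, hK.nonnegV, hK.le_oneV, hK.one_le]
    with x hx hV hV1 hW1
  set a := |inner ℝ (K x) h| with ha
  have ha0 : 0 ≤ a := abs_nonneg _
  have hW0 : 0 ≤ W x := by linarith
  have e1 : a ^ p = (a ^ 2) ^ θ * a ^ σ := by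
    rcases ha0.eq_or_lt with h0 | h0
    · rw [← h0, Real.zero_rpow (by have := hK.two_lt; linarith), Real.zero_rpow hσ.ne', mul_zero]
    · rw [← Real.rpow_natCast, ← Real.rpow_mul ha0, ← Real.rpow_add h0, hp]
      norm_num
  have e2 : (W x ^ (σ / (1 - θ))) ^ (1 - θ) = W x ^ σ := by
    rw [← Real.rpow_mul hW0, div_mul_cancel₀ _ (by linarith)]
  have hy := Real.geom_mean_le_arith_mean2_weighted hθ.le (sub_nonneg.2 hθ1.le) (sq_nonneg a)
    (Real.rpow_nonneg hW0 (σ / (1 - θ))) (by ring)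
  rw [e2] at hy
  have hw0 := Real.rpow_nonneg hW0 (σ / (1 - θ))
  have hh0 := Real.rpow_nonneg (norm_nonneg h) σ
  calc V x * a ^ p ≤ 1 * a ^ p := by gcongr
    _ = (a ^ 2) ^ θ * a ^ σ := by rw [one_mul, e1]
    _ ≤ (a ^ 2) ^ θ * (‖h‖ ^ σ * W x ^ σ) := by gcongr
    _ = ‖h‖ ^ σ * ((a ^ 2) ^ θ * W x ^ σ) := by ring
    _ ≤ ‖h‖ ^ σ * (θ * a ^ 2 + (1 - θ) * W x ^ (σ / (1 - θ))) := by gcongr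
    _ ≤ ‖h‖ ^ σ * (1 * a ^ 2 + 1 * W x ^ (σ / (1 - θ))) := by gcongr; linarith
    _ = _ := by rw [one_mul, one_mul, ha, sq_abs]

end AdmissibleKernel

/-- A power less than two is absorbed by the square. -/
lemma mul_rpow_le_sq_add {σ D : ℝ} (hσ : 0 < σ) (hσ2 : σ < 2) (hD : 0 ≤ D) :
    ∃ E, ∀ t : ℝ, 0 ≤ t → D * t ^ σ ≤ t ^ 2 / 4 + E := by
  set Y := (D * 4 ^ (σ / 2)) ^ (1 / (1 - σ / 2)) with hY
  have hY0 : 0 ≤ Y := by positivity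
  refine ⟨Y, fun t ht => ?_⟩
  have hy := Real.geom_mean_le_arith_mean2_weighted (w₁ := σ / 2) (w₂ := 1 - σ / 2)
    (p₁ := t ^ 2 / 4) (p₂ := Y) (by linarith) (by linarith) (by positivity) hY0 (by ring)
  have e1 : Y ^ (1 - σ / 2) = D * 4 ^ (σ / 2) := by
    rw [hY, ← Real.rpow_mul (by positivity), one_div_mul_cancel (by linarith), Real.rpow_one]
  have e2 : (t ^ 2 / 4) ^ (σ / 2) = t ^ σ / 4 ^ (σ / 2) := by
    rw [Real.div_rpow (by positivity) (by norm_num), ← Real.rpow_natCast, ← Real.rpow_mul ht]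
    norm_num
    congr 2
    ring
  have e3 : (0 : ℝ) < 4 ^ (σ / 2) := by positivity
  rw [e1, e2] at hy
  have e4 : t ^ σ / 4 ^ (σ / 2) * (D * 4 ^ (σ / 2)) = D * t ^ σ := by
    field_simp
  rw [e4] at hy
  have : σ / 2 * (t ^ 2 / 4) ≤ 1 * (t ^ 2 / 4) := by gcongr; linarith
  nlinarith

/-- Bounded sequences in a separable Hilbert space have weakly convergent subsequences. -/
lemma exists_weakly_convergent_subseq [CompleteSpace H] [TopologicalSpace.SeparableSpace H]
    {R : ℝ} {a : ℕ → H} (ha : ∀ n, ‖a n‖ ≤ R) :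
    ∃ (h : H) (φ : ℕ → ℕ), StrictMono φ ∧
      ∀ k : H, Tendsto (fun n => inner ℝ (a (φ n)) k) atTop (𝓝 (inner ℝ h k)) := by
  let L : ℕ → WeakDual ℝ H := fun n =>
    WeakDual.toStrongDual.symm (InnerProductSpace.toDual ℝ H (a n))
  have hL : ∀ n, L n ∈ WeakDual.toStrongDual ⁻¹' Metric.closedBall (0 : StrongDual ℝ H) R := by
    intro n
    simp only [L, Set.mem_preimage, LinearEquiv.apply_symm_apply, Metric.mem_closedBall,
      dist_zero_right, LinearIsometryEquiv.norm_map]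
    exact ha n
  obtain ⟨l, -, φ, hφ, hl⟩ := WeakDual.isSeqCompact_closedBall ℝ H 0 R hL
  refine ⟨(InnerProductSpace.toDual ℝ H).symm (WeakDual.toStrongDual l), φ, hφ, fun k => ?_⟩
  have := (tendsto_iff_forall_eval_tendsto_topDualPairing.1 hl) k
  rw [InnerProductSpace.toDual_symm_apply]
  exact this

end Variational

section Minimizer

variable {X H : Type*} [MeasurableSpace X] [NormedAddCommGroup H] [InnerProductSpace ℝ H]
  {ν : Measure X} {K : X → H} {V W : X → ℝ} {p : ℝ}

namespace AdmissibleKernel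

lemma tendsto_mass (hK : AdmissibleKernel ν K V W p) {R : ℝ} {a : ℕ → H} (ha : ∀ n, ‖a n‖ ≤ R)
    {h : H} (hw : ∀ k : H, Tendsto (fun n => inner ℝ (a n) k) atTop (𝓝 (inner ℝ h k))) :
    Tendsto (fun n => mass ν K (a n)) atTop (𝓝 (mass ν K h)) := by
  have := hK.two_lt
  have hR : 0 ≤ R := (norm_nonneg _).trans (ha 0)
  refine tendsto_integral_of_dominated_convergence (fun x => R ^ 2 * W x ^ (p + 1))
    (fun n => (hK.integrable_sq (a n)).1) (hK.integrable_rpow.const_mul _) (fun n => ?_) ?_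
  · filter_upwards [hK.abs_inner_le (a n), hK.one_le] with x hx hW
    rw [Real.norm_eq_abs, abs_pow]
    calc |inner ℝ (K x) (a n)| ^ 2 ≤ (‖a n‖ * W x) ^ 2 := by gcongr
      _ ≤ (R * W x) ^ 2 := by gcongr; exact ha n
      _ = R ^ 2 * W x ^ (2 : ℝ) := by rw [Real.rpow_two]; ring
      _ ≤ _ := by gcongr; linarith
  · refine Eventually.of_forall fun x => ?_
    simp only [real_inner_comm _ (K x)]
    exact (hw (K x)).pow 2

lemma tendsto_potential (hK : AdmissibleKernel ν K V W p) {R : ℝ} {a : ℕ → H}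
    (ha : ∀ n, ‖a n‖ ≤ R)
    {h : H} (hw : ∀ k : H, Tendsto (fun n => inner ℝ (a n) k) atTop (𝓝 (inner ℝ h k))) :
    Tendsto (fun n => potential ν K V p (a n)) atTop (𝓝 (potential ν K V p h)) := by
  have := hK.two_lt
  have hR : 0 ≤ R := (norm_nonneg _).trans (ha 0)
  refine tendsto_integral_of_dominated_convergence (fun x => R ^ p * W x ^ (p + 1))
    (fun n => hK.meas_potential (a n)) (hK.integrable_rpow.const_mul _) (fun n => ?_) ?_
  · filter_upwards [hK.potential_bound (a n), hK.one_le] with x hx hW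
    calc _ ≤ ‖a n‖ ^ p * W x ^ p := hx
      _ ≤ R ^ p * W x ^ (p + 1) := by
        gcongr
        · exact ha n
        · linarith
  · refine Eventually.of_forall fun x => ?_
    simp only [real_inner_comm _ (K x)]
    exact ((hw (K x)).abs.rpow_const (Or.inr (by linarith))).const_mul _

/-- The energy attains its minimum at prescribed mass. -/
lemma exists_minimizer [CompleteSpace H] [TopologicalSpace.SeparableSpace H]
    (hK : AdmissibleKernel ν K V W p) {σ θ : ℝ} (hp : p = 2 * θ + σ)
    (hθ : 0 < θ) (hθ1 : θ < 1) (hσ : 0 < σ) (hσ2 : σ < 2)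
    (hW : Integrable (fun x => W x ^ (σ / (1 - θ))) ν) {m : ℝ} (hm : 0 < m) {h₀ : H}
    (hh₀ : 0 < mass ν K h₀) :
    ∃ h, mass ν K h = m ∧ ∀ k, mass ν K k = m → energy ν K V p h ≤ energy ν K V p k := by
  have hp2 := hK.two_lt
  set I := ∫ x, W x ^ (σ / (1 - θ)) ∂ν with hI
  have hI0 : 0 ≤ I := integral_nonneg_of_ae <| by
    filter_upwards [hK.one_le] with x hx
    exact Real.rpow_nonneg (by linarith) _
  obtain ⟨E, hE⟩ := mul_rpow_le_sq_add hσ hσ2 (D := (m + I) / p) (by positivity)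
  have low : ∀ h, mass ν K h = m → ‖h‖ ^ 2 / 4 - E ≤ energy ν K V p h := by
    intro h hh
    have h1 := hK.potential_le hp hθ hθ1 hσ hW h
    rw [hh, ← hI] at h1
    have h2 := hE ‖h‖ (norm_nonneg _)
    have h3 : potential ν K V p h / p ≤ (m + I) / p * ‖h‖ ^ σ := by
      rw [div_mul_eq_mul_div]
      gcongr
      linarith
    rw [energy]
    linarith
  set S := energy ν K V p '' {h | mass ν K h = m} with hS
  have hne : S.Nonempty := by
    refine ⟨_, (√(m / mass ν K h₀)) • h₀, ?_, rfl⟩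
    rw [Set.mem_ofPred_eq, mass_smul, Real.sq_sqrt (by positivity), div_mul_cancel₀ _ hh₀.ne']
  have hbdd : BddBelow S := by
    refine ⟨-E, ?_⟩
    rintro _ ⟨h, hh, rfl⟩
    have := low h hh
    nlinarith [sq_nonneg ‖h‖]
  obtain ⟨e, -, he, heS⟩ := exists_seq_tendsto_sInf hne hbdd
  choose a ha hae using heS
  obtain ⟨B, hB⟩ := he.bddAbove_range
  have hbound : ∀ n, ‖a n‖ ≤ √(4 * (B + E)) := by
    intro n
    apply Real.le_sqrt_of_sq_le
    have h1 := low _ (ha n)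
    have h2 : e n ≤ B := hB ⟨n, rfl⟩
    rw [hae n] at h1
    linarith
  obtain ⟨h, φ, hφ, hw⟩ := exists_weakly_convergent_subseq hbound
  have hM := hK.tendsto_mass (fun n => hbound (φ n)) hw
  have hP := hK.tendsto_potential (fun n => hbound (φ n)) hw
  have hmh : mass ν K h = m := by
    refine tendsto_nhds_unique hM ?_
    simp only [show ∀ n, mass ν K (a (φ n)) = m from fun n => ha (φ n)]
    exact tendsto_const_nhds
  refine ⟨h, hmh, fun k hk => ?_⟩
  have hle : energy ν K V p h ≤ sInf S := by
    have t1 : Tendsto (fun n => inner ℝ (a (φ n)) h - ‖h‖ ^ 2 / 2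
        - potential ν K V p (a (φ n)) / p) atTop (𝓝 (energy ν K V p h)) := by
      have := ((hw h).sub_const (‖h‖ ^ 2 / 2)).sub (hP.div_const p)
      convert! this using 2
      rw [energy, real_inner_self_eq_norm_sq]
      ring
    refine le_of_tendsto_of_tendsto t1 (he.comp hφ.tendsto_atTop) (Eventually.of_forall fun n => ?_)
    simp only [Function.comp, ← hae, energy]
    have := norm_sub_sq_real (a (φ n)) h
    nlinarith [sq_nonneg ‖a (φ n) - h‖]
  exact hle.trans (csInf_le hbdd ⟨k, hk, rfl⟩)

/-- The nonlinearity tested against a function of the kernel space. -/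
lemma hasDerivAt_potential (hK : AdmissibleKernel ν K V W p) (h k : H) :
    HasDerivAt (fun t : ℝ => potential ν K V p (h + t • k))
      (p * ∫ x, V x * |inner ℝ (K x) h| ^ (p - 2) * inner ℝ (K x) h * inner ℝ (K x) k ∂ν) 0 := by
  have hp2 := hK.two_lt
  have hc : Continuous (fun t : ℝ => |t| ^ (p - 2) * t) :=
    (continuous_abs.rpow_const fun _ => Or.inr (by linarith)).mul continuous_id
  have key := hasDerivAt_integral_of_dominated_loc_of_deriv_le (μ := ν) (x₀ := (0 : ℝ))
    (s := Metric.ball 0 1)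
    (F := fun t x => V x * |inner ℝ (K x) (h + t • k)| ^ p)
    (F' := fun t x => V x * (p * |inner ℝ (K x) (h + t • k)| ^ (p - 2)
      * inner ℝ (K x) (h + t • k) * inner ℝ (K x) k))
    (bound := fun x => p * (‖h‖ + ‖k‖) ^ (p - 1) * ‖k‖ * W x ^ (p + 1))
    (Metric.ball_mem_nhds _ one_pos)
    (Eventually.of_forall fun t => hK.meas_potential _)
    (hK.integrable_potential _)
    (by
      have := (hK.measV.mul ((hc.comp_aestronglyMeasurable (hK.meas (h + (0 : ℝ) • k))).mul
        (hK.meas k))).const_mul p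
      refine this.congr (Eventually.of_forall fun x => ?_)
      simp
      ring)
    (by
      filter_upwards [hK.abs_inner_le h, hK.abs_inner_le k, hK.nonnegV, hK.le_oneV, hK.one_le]
        with x hh hk hV hV1 hW t ht
      rw [Metric.mem_ball, dist_zero_right, Real.norm_eq_abs] at ht
      set b := inner ℝ (K x) (h + t • k) with hb
      have hb1 : |b| ≤ (‖h‖ + ‖k‖) * W x := by
        rw [hb, inner_add_right, inner_smul_right]
        calc _ ≤ |inner ℝ (K x) h| + |t * inner ℝ (K x) k| := abs_add_le _ _
          _ ≤ ‖h‖ * W x + 1 * (‖k‖ * W x) := by rw [abs_mul]; gcongr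
          _ = _ := by ring
      have e1 : |b| ^ (p - 2) * |b| = |b| ^ (p - 1) := by
        rw [← Real.rpow_add_one' (abs_nonneg _) (by linarith)]
        ring_nf
      rw [Real.norm_eq_abs, abs_mul, abs_mul, abs_mul, abs_mul, abs_of_nonneg hV,
        abs_of_nonneg (by linarith : 0 ≤ p), abs_of_nonneg (by positivity : 0 ≤ |b| ^ (p - 2))]
      calc _ = V x * (p * (|b| ^ (p - 2) * |b|) * |inner ℝ (K x) k|) := by ring
        _ ≤ 1 * (p * ((‖h‖ + ‖k‖) * W x) ^ (p - 1) * (‖k‖ * W x)) := by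
          rw [e1]
          gcongr
          linarith
        _ = p * (‖h‖ + ‖k‖) ^ (p - 1) * ‖k‖ * (W x ^ (p - 1) * W x) := by
          rw [Real.mul_rpow (by positivity) (by linarith)]
          ring
        _ = p * (‖h‖ + ‖k‖) ^ (p - 1) * ‖k‖ * W x ^ p := by
          rw [← Real.rpow_add_one (by linarith)]
          ring_nf
        _ ≤ _ := by
          gcongr
          linarith)
    (hK.integrable_rpow.const_mul _)
    (by
      refine Eventually.of_forall fun x t _ => ?_
      have h1 : HasDerivAt (fun t : ℝ => inner ℝ (K x) (h + t • k)) (inner ℝ (K x) k) t := by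
        simp only [inner_add_right, inner_smul_right]
        simpa using ((hasDerivAt_id t).mul_const (inner ℝ (K x) k)).const_add (inner ℝ (K x) h)
      exact ((hasDerivAt_abs_rpow _ (by linarith)).comp t h1).const_mul (V x))
  convert! key.2 using 1
  rw [← integral_const_mul]
  congr 1 with x
  simp
  ring

/-- The Euler-Lagrange equation of a minimizer of the energy at prescribed mass. -/
lemma euler_lagrange (hK : AdmissibleKernel ν K V W p) {m : ℝ} (hm : 0 < m) {h : H}
    (hh : mass ν K h = m)
    (hmin : ∀ k, mass ν K k = m → energy ν K V p h ≤ energy ν K V p k) (k : H) :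
    inner ℝ h k =
      ∫ x, (V x * |inner ℝ (K x) h| ^ (p - 2) * inner ℝ (K x) h
        - (potential ν K V p h - ‖h‖ ^ 2) / m * inner ℝ (K x) h) * inner ℝ (K x) k ∂ν := by
  have hp2 := hK.two_lt
  set b := ∫ x, inner ℝ (K x) h * inner ℝ (K x) k ∂ν with hb
  set D := ∫ x, V x * |inner ℝ (K x) h| ^ (p - 2) * inner ℝ (K x) h * inner ℝ (K x) k ∂ν with hD
  set P := potential ν K V p h with hP
  let M : ℝ → ℝ := fun t => m + 2 * t * b + t ^ 2 * mass ν K k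
  have hM : ∀ t, mass ν K (h + t • k) = M t := fun t => by rw [hK.mass_add_smul, hh]
  let Q : ℝ → ℝ := fun t => ‖h‖ ^ 2 + 2 * t * inner ℝ h k + t ^ 2 * ‖k‖ ^ 2
  have hQ : ∀ t, ‖h + t • k‖ ^ 2 = Q t := fun t => by
    rw [norm_add_sq_real, inner_smul_right, norm_smul, mul_pow, Real.norm_eq_abs, sq_abs]
    ring
  have dM : HasDerivAt M (2 * b) 0 := by
    have := (((hasDerivAt_id (0 : ℝ)).const_mul 2).mul_const b).const_add m
    have h2 := ((hasDerivAt_id (0 : ℝ)).pow 2).mul_const (mass ν K k)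
    convert! this.add h2 using 1
    simp
  have dQ : HasDerivAt Q (2 * inner ℝ h k) 0 := by
    have := (((hasDerivAt_id (0 : ℝ)).const_mul 2).mul_const (inner ℝ h k)).const_add (‖h‖ ^ 2)
    have h2 := ((hasDerivAt_id (0 : ℝ)).pow 2).mul_const (‖k‖ ^ 2)
    convert! this.add h2 using 1
    simp
  have M0 : M 0 = m := by simp [M]
  have Q0 : Q 0 = ‖h‖ ^ 2 := by simp [Q]
  have dR : HasDerivAt (fun t => m / M t) (-(2 * b / m)) 0 := by
    have := (hasDerivAt_const (0 : ℝ) m).div dM (by rw [M0]; exact hm.ne')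
    convert! this using 1
    rw [M0]
    field_simp
    ring
  have R0 : m / M 0 = 1 := by rw [M0, div_self hm.ne']
  have dRp : HasDerivAt (fun t => (m / M t) ^ (p / 2)) (-(2 * b / m) * (p / 2)) 0 := by
    have := dR.rpow_const (p := p / 2) (Or.inl (by rw [R0]; exact one_ne_zero))
    simpa [R0] using this
  have dP := hK.hasDerivAt_potential h k
  rw [← hD] at dP
  have P0 : potential ν K V p (h + (0 : ℝ) • k) = P := by simp [hP]
  have dJ := ((dR.mul dQ).div_const 2).sub ((dRp.mul dP).div_const p)
  have hloc : IsLocalMin ((fun t => (m / M t * Q t) / 2)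
      - fun t => ((m / M t) ^ (p / 2) * potential ν K V p (h + t • k)) / p) 0 := by
    have hpos : ∀ᶠ t in 𝓝 (0 : ℝ), 0 < M t :=
      dM.continuousAt.eventually (lt_mem_nhds (by rw [M0]; exact hm))
    filter_upwards [hpos] with t ht
    have h1 := hmin ((√(m / M t)) • (h + t • k))
      (by rw [mass_smul, hM, Real.sq_sqrt (by positivity), div_mul_cancel₀ _ ht.ne'])
    have e1 : (√(m / M t)) ^ p = (m / M t) ^ (p / 2) := by
      rw [Real.sqrt_eq_rpow, ← Real.rpow_mul (by positivity)]
      ring_nf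
    simp only [Pi.sub_apply, R0, Q0, P0, Real.one_rpow, one_mul]
    rw [energy, energy, norm_smul, mul_pow, Real.norm_eq_abs, sq_abs,
      Real.sq_sqrt (by positivity), potential_smul (Real.sqrt_nonneg _), e1, hQ] at h1
    exact h1
  have h0 := hloc.hasDerivAt_eq_zero dJ
  simp only [R0, Q0, P0, Real.one_rpow, one_mul] at h0
  have key : inner ℝ h k = D - (P - ‖h‖ ^ 2) / m * b := by
    field_simp at h0 ⊢
    linarith
  rw [key, hD, hb, ← integral_const_mul, ← integral_sub]
  · congr 1 with x
    ring
  · have hc : Continuous (fun t : ℝ => |t| ^ (p - 2) * t) :=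
      (continuous_abs.rpow_const fun _ => Or.inr (by linarith)).mul continuous_id
    refine hK.integrable_of_le ?_ (‖h‖ ^ (p - 2) * ‖h‖ * ‖k‖) (q := p) (by linarith) ?_
    · refine (hK.measV.mul ((hc.comp_aestronglyMeasurable (hK.meas h)).mul (hK.meas k))).congr
        (Eventually.of_forall fun x => ?_)
      simp
      ring
    · filter_upwards [hK.abs_inner_le h, hK.abs_inner_le k, hK.nonnegV, hK.le_oneV, hK.one_le,
        hK.abs_inner_rpow_le h (q := p - 2) (by linarith)] with x hh hk hV hV1 hW hr
      rw [abs_mul, abs_mul, abs_mul, abs_of_nonneg hV,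
        abs_of_nonneg (by positivity : 0 ≤ |inner ℝ (K x) h| ^ (p - 2))]
      have e2 : W x ^ (p - 2) * W x * W x = W x ^ p := by
        rw [← Real.rpow_add_one (by linarith), ← Real.rpow_add_one (by linarith)]
        ring_nf
      calc _ ≤ 1 * (‖h‖ ^ (p - 2) * W x ^ (p - 2)) * (‖h‖ * W x) * (‖k‖ * W x) := by gcongr
        _ = ‖h‖ ^ (p - 2) * ‖h‖ * ‖k‖ * (W x ^ (p - 2) * W x * W x) := by ring
        _ = _ := by rw [e2]
  · exact (hK.integrable_mul h k).const_mul _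

end AdmissibleKernel

end Minimizer

section RadialKernel

variable {H : Type*} [NormedAddCommGroup H] [InnerProductSpace ℝ H]

/-- The measure `r ^ d dr` on the unit interval. -/
def radialMeasure (d : ℕ) : Measure ℝ :=
  (volume.restrict (Ioo 0 1)).withDensity fun r => ((r ^ d).toNNReal : ENNReal)

lemma integral_radialMeasure (d : ℕ) (g : ℝ → ℝ) :
    ∫ r, g r ∂radialMeasure d = ∫ r in Ioo (0 : ℝ) 1, r ^ d * g r := by
  rw [radialMeasure, integral_withDensity_eq_integral_smul (by fun_prop)]
  refine setIntegral_congr_fun measurableSet_Ioo fun r hr => ?_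
  simp only [NNReal.smul_def, smul_eq_mul]
  rw [Real.coe_toNNReal _ (pow_nonneg hr.1.le _)]

lemma radialMeasure_absolutelyContinuous (d : ℕ) :
    radialMeasure d ≪ volume.restrict (Ioo 0 1) :=
  withDensity_absolutelyContinuous _ _

lemma ae_radialMeasure_mem (d : ℕ) : ∀ᵐ r ∂radialMeasure d, r ∈ Ioo (0 : ℝ) 1 :=
  (radialMeasure_absolutelyContinuous d).ae_le (ae_restrict_mem measurableSet_Ioo)

lemma ContinuousOn.aestronglyMeasurable_radialMeasure {d : ℕ} {g : ℝ → ℝ}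
    (hg : ContinuousOn g (Ioo 0 1)) : AEStronglyMeasurable g (radialMeasure d) :=
  (hg.aestronglyMeasurable measurableSet_Ioo).mono_ac (radialMeasure_absolutelyContinuous d)

lemma integrable_radialMeasure_iff {d : ℕ} {g : ℝ → ℝ} :
    Integrable g (radialMeasure d) ↔ IntegrableOn (fun r => r ^ d * g r) (Ioo 0 1) := by
  rw [radialMeasure, integrable_withDensity_iff_integrable_smul (by fun_prop), IntegrableOn]
  refine integrable_congr ?_
  filter_upwards [ae_restrict_mem measurableSet_Ioo] with r hr
  rw [NNReal.smul_def, smul_eq_mul, Real.coe_toNNReal _ (pow_nonneg hr.1.le _)]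

/-- The function `G` is the radial Green function with vanishing value at `1`:
`r ^ d * G' = -1`. -/
structure IsRadialGreen (d : ℕ) (G : ℝ → ℝ) : Prop where
  hasDerivAt : ∀ r, 0 < r → HasDerivAt G (-(r ^ d)⁻¹) r
  map_one : G 1 = 0

namespace IsRadialGreen

variable {d : ℕ} {G : ℝ → ℝ}

lemma continuousOn (hG : IsRadialGreen d G) : ContinuousOn G (Ioi 0) :=
  fun r hr => (hG.hasDerivAt r hr).continuousAt.continuousWithinAt

lemma strictAntiOn (hG : IsRadialGreen d G) : StrictAntiOn G (Ioi 0) := by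
  refine strictAntiOn_of_deriv_neg (convex_Ioi 0) hG.continuousOn fun r hr => ?_
  rw [interior_Ioi] at hr
  rw [(hG.hasDerivAt r hr).deriv, neg_lt_zero]
  exact inv_pos.2 (pow_pos hr d)

lemma nonneg (hG : IsRadialGreen d G) {r : ℝ} (h0 : 0 < r) (h1 : r ≤ 1) : 0 ≤ G r :=
  hG.map_one ▸ hG.strictAntiOn.antitoneOn h0 (zero_lt_one (α := ℝ)) h1

lemma pos (hG : IsRadialGreen d G) {r : ℝ} (h0 : 0 < r) (h1 : r < 1) : 0 < G r :=
  hG.map_one ▸ hG.strictAntiOn h0 (zero_lt_one (α := ℝ)) h1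

end IsRadialGreen

/-- The family `K` has the Green function `G` as its Gram matrix. -/
def IsGreenFamily (G : ℝ → ℝ) (K : ℝ → H) : Prop :=
  ∀ r ∈ Ioc (0 : ℝ) 1, ∀ s ∈ Ioc (0 : ℝ) 1, inner ℝ (K r) (K s) = G (max r s)

lemma exists_isGreenFamily {d : ℕ} {G : ℝ → ℝ} (hG : IsRadialGreen d G) :
    ∃ K : ℝ → Lp ℝ 2 (volume : Measure ℝ), IsGreenFamily G K := by
  have hfin : ∀ r, volume (Ioc 0 (G r)) ≠ ⊤ := fun r => by simp
  refine ⟨fun r => indicatorConstLp 2 measurableSet_Ioc (hfin r) 1, fun r hr s hs => ?_⟩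
  rw [L2.real_inner_indicatorConstLp_one_indicatorConstLp_one (hμs := hfin r) (hμt := hfin s),
    Ioc_inter_Ioc, max_self]
  have hm : max r s ∈ Ioc (0 : ℝ) 1 := ⟨lt_max_of_lt_left hr.1, max_le hr.2 hs.2⟩
  have : min (G r) (G s) = G (max r s) := (hG.strictAntiOn.antitoneOn.map_max hr.1 hs.1).symm
  rw [this, measureReal_def, Real.volume_Ioc, sub_zero,
    ENNReal.toReal_ofReal (hG.nonneg hm.1 hm.2)]

namespace IsGreenFamily

variable {d : ℕ} {G : ℝ → ℝ} {K : ℝ → H}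

lemma norm_sq (hK : IsGreenFamily G K) {r : ℝ} (hr : r ∈ Ioc (0 : ℝ) 1) : ‖K r‖ ^ 2 = G r := by
  rw [← real_inner_self_eq_norm_sq, hK r hr r hr, max_self]

lemma continuousOn (hK : IsGreenFamily G K) (hG : IsRadialGreen d G) :
    ContinuousOn K (Ioc 0 1) := by
  intro s hs
  rw [ContinuousWithinAt, tendsto_iff_norm_sub_tendsto_zero]
  have h1 : Tendsto (fun r => √(G r - 2 * G (max r s) + G s)) (𝓝[Ioc 0 1] s) (𝓝 0) := by
    have c1 : ContinuousAt G s := (hG.hasDerivAt s hs.1).continuousAt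
    have c2 : ContinuousAt (fun r => G (max r s)) s := by
      refine ContinuousAt.comp (f := fun r => max r s) ?_ (by fun_prop)
      simpa using c1
    have : ContinuousAt (fun r => √(G r - 2 * G (max r s) + G s)) s :=
      ((c1.sub (continuousAt_const.mul c2)).add continuousAt_const).sqrt
    have h := this.tendsto.mono_left (nhdsWithin_le_nhds (s := Ioc 0 1))
    convert! h using 2
    rw [max_self, show G s - 2 * G s + G s = 0 by ring, Real.sqrt_zero]
  refine h1.congr' ?_
  filter_upwards [self_mem_nhdsWithin] with r hr
  rw [← hK.norm_sq hr, ← hK.norm_sq hs, ← hK r hr s hs, ← norm_sub_sq_real,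
    Real.sqrt_sq (norm_nonneg _)]

/-- Reflecting a function of the kernel space at height `u r₀` on `(0, r₀)` is an isometry. -/
lemma exists_reflection [CompleteSpace H] (hK : IsGreenFamily G K) {r₀ : ℝ}
    (hr₀ : r₀ ∈ Ioc (0 : ℝ) 1) (h : H) :
    ∃ h', ‖h'‖ = ‖h‖ ∧
      (∀ r ∈ Ioo 0 r₀, inner ℝ (K r) h' = 2 * inner ℝ (K r₀) h - inner ℝ (K r) h) ∧
      ∀ r ∈ Icc r₀ 1, inner ℝ (K r) h' = inner ℝ (K r) h := by
  set S : Submodule ℝ H := Submodule.span ℝ ((fun r => K r - K r₀) '' Ioo 0 r₀) with hS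
  have hmem : ∀ r ∈ Icc r₀ 1, K r ∈ Sᗮ := by
    intro r hr
    suffices h : S ⟂ Submodule.span ℝ {K r} from
      h.symm (Submodule.mem_span_singleton_self _)
    rw [hS, Submodule.isOrtho_span]
    rintro _ ⟨t, ht, rfl⟩ _ rfl
    have hr' : r ∈ Ioc (0 : ℝ) 1 := ⟨hr₀.1.trans_le hr.1, hr.2⟩
    have ht' : t ∈ Ioc (0 : ℝ) 1 := ⟨ht.1, ht.2.le.trans hr₀.2⟩
    rw [inner_sub_left, hK t ht' r hr', hK r₀ hr₀ r hr', max_eq_right (ht.2.le.trans hr.1),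
      max_eq_right hr.1, sub_self]
  have hin : ∀ v, inner ℝ v (Sᗮ.reflection h) = inner ℝ (Sᗮ.reflection v) h := by
    intro v
    rw [← (Sᗮ.reflection).inner_map_map v, Submodule.reflection_reflection]
  have h2 : ∀ r ∈ Icc r₀ 1, inner ℝ (K r) (Sᗮ.reflection h) = inner ℝ (K r) h := by
    intro r hr
    rw [hin, Submodule.reflection_mem_subspace_eq_self (hmem r hr)]
  refine ⟨Sᗮ.reflection h, LinearIsometryEquiv.norm_map _ _, fun r hr => ?_, h2⟩
  have h3 : K r - K r₀ ∈ S := Submodule.subset_span ⟨r, hr, rfl⟩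
  have h4 : inner ℝ (K r - K r₀) (Sᗮ.reflection h) = -inner ℝ (K r - K r₀) h := by
    rw [hin, Submodule.reflection_mem_subspace_orthogonalComplement_eq_neg
      (Submodule.le_orthogonal_orthogonal S h3), inner_neg_left]
  rw [inner_sub_left, inner_sub_left, h2 r₀ ⟨le_rfl, hr₀.2⟩] at h4
  linarith

end IsGreenFamily

end RadialKernel

/-- The radial Euler-Lagrange problem in integral form, with the information on nodal points that
comes from minimality. -/
lemma exists_integral_solution {d : ℕ} {p σ θ m : ℝ} {G W V : ℝ → ℝ} (hG : IsRadialGreen d G)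
    (hp2 : 2 < p) (hp : p = 2 * θ + σ) (hθ : 0 < θ) (hθ1 : θ < 1) (hσ : 0 < σ) (hσ2 : σ < 2)
    (hW1 : ∀ r ∈ Ioo (0 : ℝ) 1, 1 ≤ W r)
    (hGW : ∀ r ∈ Ioo (0 : ℝ) 1, G r ≤ W r ^ 2)
    (hWp : Integrable (fun r => W r ^ (p + 1)) (radialMeasure d))
    (hWσ : Integrable (fun r => W r ^ (σ / (1 - θ))) (radialMeasure d))
    (hVc : ContinuousOn V (Icc 0 1)) (hV0 : ∀ r ∈ Icc (0 : ℝ) 1, 0 < V r)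
    (hV1 : ∀ r ∈ Icc (0 : ℝ) 1, V r ≤ 1) (hm : 0 < m) :
    ∃ (lam : ℝ) (U : ℝ → ℝ), ContinuousOn U (Icc 0 1) ∧ U 1 = 0 ∧
      ∫ r, U r ^ 2 ∂radialMeasure d = m ∧
      (∀ s ∈ Icc (0 : ℝ) 1, U s =
        ∫ r, (V r * |U r| ^ (p - 2) * U r - lam * U r) * G (max r s) ∂radialMeasure d) ∧
      ∀ r₀ ∈ Ioo (0 : ℝ) 1, U r₀ = 0 →
        ∫ r, (Iio r₀).indicator (fun r => V r * |U r| ^ (p - 2) * U r - lam * U r) r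
          ∂radialMeasure d = 0 := by
  obtain ⟨K, hKG⟩ := exists_isGreenFamily hG
  have : Fact ((2 : ENNReal) ≠ ⊤) := ⟨by norm_num⟩
  set ν := radialMeasure d with hν
  have hae := ae_radialMeasure_mem d
  have hKc := hKG.continuousOn hG
  have hIoo : Ioo (0 : ℝ) 1 ⊆ Ioc 0 1 := Ioo_subset_Ioc_self
  have hIoo' : Ioo (0 : ℝ) 1 ⊆ Icc 0 1 := Ioo_subset_Icc_self
  have hK : AdmissibleKernel ν K V W p :=
    { two_lt := hp2
      meas := fun h => ContinuousOn.aestronglyMeasurable_radialMeasure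
        ((hKc.mono hIoo).inner continuousOn_const)
      measV := ContinuousOn.aestronglyMeasurable_radialMeasure (hVc.mono hIoo')
      nonnegV := by filter_upwards [hae] with r hr using (hV0 r (hIoo' hr)).le
      le_oneV := by filter_upwards [hae] with r hr using hV1 r (hIoo' hr)
      norm_le := by
        filter_upwards [hae] with r hr
        have h1 := hW1 r hr
        refine (sq_le_sq₀ (norm_nonneg _) (by linarith)).1 ?_
        rw [hKG.norm_sq (hIoo hr)]
        exact hGW r hr
      one_le := by filter_upwards [hae] with r hr using hW1 r hr
      integrable_rpow := hWp }
  have hhalf : (1 / 2 : ℝ) ∈ Ioc (0 : ℝ) 1 := by norm_num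
  have hpos : 0 < mass ν K (K (1 / 2)) := by
    rw [mass, hν, integral_radialMeasure]
    have hi := integrable_radialMeasure_iff.1 (hK.integrable_sq (K (1 / 2)))
    rw [setIntegral_pos_iff_support_of_nonneg_ae]
    · refine lt_of_lt_of_le ?_ (measure_mono (s := Ioo 0 1) fun r hr => ⟨?_, hr⟩)
      · simp
      · rw [Function.mem_support, hKG r (hIoo hr) _ hhalf]
        have : 0 < G (max r (1 / 2)) :=
          hG.pos (lt_max_of_lt_left hr.1) (max_lt hr.2 (by norm_num))
        have := hr.1
        positivity
    · filter_upwards [ae_restrict_mem measurableSet_Ioo] with r hr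
      have := hr.1
      simp only [Pi.zero_apply]
      positivity
    · exact hi
  obtain ⟨h, hhm, hmin⟩ := hK.exists_minimizer hp hθ hθ1 hσ hσ2 hWσ hm hpos
  set lam := (potential ν K V p h - ‖h‖ ^ 2) / m with hlam
  let u : ℝ → ℝ := fun r => inner ℝ (K r) h
  let f : ℝ → ℝ := fun r => V r * |u r| ^ (p - 2) * u r - lam * u r
  have hmeasf : AEStronglyMeasurable f ν := by
    have hc : Continuous (fun t : ℝ => |t| ^ (p - 2) * t) :=
      (continuous_abs.rpow_const fun _ => Or.inr (by linarith)).mul continuous_id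
    refine ((hK.measV.mul (hc.comp_aestronglyMeasurable (hK.meas h))).sub
      ((hK.meas h).const_mul lam)).congr (Eventually.of_forall fun x => ?_)
    simp [f, u]
    ring
  have hf_bound : ∀ᵐ r ∂ν, |f r| ≤ (‖h‖ ^ (p - 2) * ‖h‖ + |lam| * ‖h‖) * W r ^ (p - 1) := by
    filter_upwards [hK.abs_inner_le h, hK.nonnegV, hK.le_oneV, hK.one_le,
      hK.abs_inner_rpow_le h (q := p - 2) (by linarith)] with r hr hVr hVr1 hWr hpr
    have e1 : W r ^ (p - 2) * W r = W r ^ (p - 1) := by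
      rw [← Real.rpow_add_one (by linarith)]
      ring_nf
    have e2 : W r ≤ W r ^ (p - 1) := by
      conv_lhs => rw [← Real.rpow_one (W r)]
      gcongr
      linarith
    calc |f r| ≤ |V r * |u r| ^ (p - 2) * u r| + |lam * u r| := abs_sub _ _
      _ = V r * |u r| ^ (p - 2) * |u r| + |lam| * |u r| := by
        rw [abs_mul, abs_mul, abs_mul, abs_of_nonneg hVr,
          abs_of_nonneg (by positivity : 0 ≤ |u r| ^ (p - 2))]
      _ ≤ 1 * (‖h‖ ^ (p - 2) * W r ^ (p - 2)) * (‖h‖ * W r) + |lam| * (‖h‖ * W r) := by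
        gcongr
      _ = ‖h‖ ^ (p - 2) * ‖h‖ * (W r ^ (p - 2) * W r) + |lam| * ‖h‖ * W r := by ring
      _ ≤ ‖h‖ ^ (p - 2) * ‖h‖ * W r ^ (p - 1) + |lam| * ‖h‖ * W r ^ (p - 1) := by
        rw [e1]
        gcongr
      _ = _ := by ring
  have hmeasG : ∀ s : ℝ, AEStronglyMeasurable (fun r => G (max r s)) ν := fun s => by
    refine ContinuousOn.aestronglyMeasurable_radialMeasure (hG.continuousOn.comp (by fun_prop) ?_)
    intro r hr
    exact lt_max_of_lt_left hr.1
  set D := (‖h‖ ^ (p - 2) * ‖h‖ + |lam| * ‖h‖) with hD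
  have hfG : ∀ s ∈ Icc (0 : ℝ) 1, ∀ᵐ r ∂ν, ‖f r * G (max r s)‖ ≤ D * W r ^ (p + 1) := by
    intro s hs
    filter_upwards [hf_bound, hae] with r hr hr'
    have h1 : 0 ≤ G (max r s) := hG.nonneg (lt_max_of_lt_left hr'.1) (max_le hr'.2.le hs.2)
    have h2 : G (max r s) ≤ W r ^ 2 :=
      (hG.strictAntiOn.antitoneOn hr'.1 (lt_max_of_lt_left hr'.1) (le_max_left _ _)).trans
        (hGW r hr')
    have h3 := hW1 r hr'
    have e1 : W r ^ (p - 1) * W r ^ 2 = W r ^ (p + 1) := by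
      rw [← Real.rpow_natCast, ← Real.rpow_add (by linarith)]
      norm_num
      ring_nf
    rw [norm_mul, Real.norm_eq_abs, Real.norm_eq_abs, abs_of_nonneg h1]
    calc _ ≤ (D * W r ^ (p - 1)) * W r ^ 2 := by gcongr
      _ = D * W r ^ (p + 1) := by rw [mul_assoc, e1]
  have hfG_int : ∀ s ∈ Icc (0 : ℝ) 1, Integrable (fun r => f r * G (max r s)) ν := fun s hs =>
    (hWp.const_mul D).mono' (hmeasf.mul (hmeasG s)) (hfG s hs)
  let U : ℝ → ℝ := fun s => ∫ r, f r * G (max r s) ∂ν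
  have hUu : ∀ s ∈ Ioc (0 : ℝ) 1, U s = u s := by
    intro s hs
    have h1 := hK.euler_lagrange hm hhm hmin (K s)
    rw [real_inner_comm] at h1
    refine Eq.trans ?_ h1.symm
    refine integral_congr_ae ?_
    filter_upwards [hae] with r hr
    rw [hKG r (hIoo hr) s hs]
  have hfU : ∀ᵐ r ∂ν, V r * |U r| ^ (p - 2) * U r - lam * U r = f r := by
    filter_upwards [hae] with r hr
    simp only [hUu r (hIoo hr), f]
  refine ⟨lam, U, ?_, ?_, ?_, ?_, ?_⟩
  · refine continuousOn_of_dominated (fun s _ => hmeasf.mul (hmeasG s)) hfG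
      (hWp.const_mul D) ?_
    filter_upwards [hae] with r hr
    refine ContinuousOn.mul continuousOn_const (hG.continuousOn.comp (by fun_prop) ?_)
    intro s _
    exact lt_max_of_lt_left hr.1
  · have h1 : (1 : ℝ) ∈ Ioc (0 : ℝ) 1 := by norm_num
    have h2 := hKG.norm_sq h1
    rw [hG.map_one, sq_eq_zero_iff, norm_eq_zero] at h2
    simp only [hUu 1 h1, u, h2, inner_zero_left]
  · rw [← hhm, mass]
    refine integral_congr_ae ?_
    filter_upwards [hae] with r hr
    rw [hUu r (hIoo hr)]
  · intro s hs
    refine integral_congr_ae ?_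
    filter_upwards [hfU] with r hr
    rw [hr]
  · intro r₀ hr₀ h0
    have hr₀' := hIoo hr₀
    obtain ⟨h', hn, hlt, hge⟩ := hKG.exists_reflection hr₀' h
    rw [hUu r₀ hr₀'] at h0
    have habs : ∀ r ∈ Ioo (0 : ℝ) 1, |inner ℝ (K r) h'| = |inner ℝ (K r) h| := by
      intro r hr
      rcases lt_or_ge r r₀ with hr' | hr'
      · rw [hlt r ⟨hr.1, hr'⟩, show inner ℝ (K r₀) h = 0 from h0, mul_zero, zero_sub, abs_neg]
      · rw [hge r ⟨hr', hr.2.le⟩]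
    have hP : potential ν K V p h' = potential ν K V p h := by
      refine integral_congr_ae ?_
      filter_upwards [hae] with r hr
      rw [habs r hr]
    have hM : mass ν K h' = mass ν K h := by
      refine integral_congr_ae ?_
      filter_upwards [hae] with r hr
      rw [← sq_abs, habs r hr, sq_abs]
    have hE : energy ν K V p h' = energy ν K V p h := by rw [energy, energy, hP, hn]
    have h1 := hK.euler_lagrange hm (hM.trans hhm) (fun k hk => hE.le.trans (hmin k hk)) (K r₀)
    have h2 := hUu r₀ hr₀'
    rw [hP, hn, ← hlam, real_inner_comm, hge r₀ ⟨le_rfl, hr₀.2.le⟩,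
      show inner ℝ (K r₀) h = 0 from h0] at h1
    rw [h0] at h2
    have h3 : ∫ r, (f r * G (max r r₀)
        - (V r * |inner ℝ (K r) h'| ^ (p - 2) * inner ℝ (K r) h' - lam * inner ℝ (K r) h')
          * inner ℝ (K r) (K r₀)) ∂ν = 0 := by
      rw [integral_sub (hfG_int r₀ (hIoo' hr₀)) ?_, ← h1, sub_zero]
      · exact h2
      · refine (hfG_int r₀ (hIoo' hr₀)).mono ?_ ?_
        · have hc : Continuous (fun t : ℝ => |t| ^ (p - 2) * t) :=
            (continuous_abs.rpow_const fun _ => Or.inr (by linarith)).mul continuous_id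
          refine (((hK.measV.mul (hc.comp_aestronglyMeasurable (hK.meas h'))).sub
            ((hK.meas h').const_mul lam)).mul (hK.meas (K r₀))).congr
              (Eventually.of_forall fun x => ?_)
          simp
          ring_nf
          simp
        · filter_upwards [hae] with r hr
          rw [hKG r (hIoo hr) _ hr₀', norm_mul, norm_mul]
          have : V r * |inner ℝ (K r) h'| ^ (p - 2) * inner ℝ (K r) h' - lam * inner ℝ (K r) h'
              = (V r * |inner ℝ (K r) h'| ^ (p - 2) - lam) * inner ℝ (K r) h' := by ring
          rw [this, norm_mul, Real.norm_eq_abs (inner ℝ (K r) h'), habs r hr]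
          simp only [f, u]
          rw [← sub_mul, norm_mul, Real.norm_eq_abs (inner ℝ (K r) h)]
    have h4 : ∫ r, 2 * G r₀ * (Iio r₀).indicator
        (fun r => V r * |U r| ^ (p - 2) * U r - lam * U r) r ∂ν = 0 := by
      rw [← h3]
      refine integral_congr_ae ?_
      filter_upwards [hae, hfU] with r hr hfr
      rw [hKG r (hIoo hr) _ hr₀']
      rcases lt_or_ge r r₀ with hr' | hr'
      · rw [indicator_of_mem (by exact hr'), hfr, habs r hr, hlt r ⟨hr.1, hr'⟩,
          show inner ℝ (K r₀) h = 0 from h0, max_eq_right hr'.le]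
        simp only [f, u]
        ring
      · rw [indicator_of_notMem (by simpa using hr'), hge r ⟨hr', hr.2.le⟩]
        simp only [f, u]
        ring
    rw [integral_const_mul] at h4
    have h5 := hG.pos hr₀.1 hr₀.2
    rcases mul_eq_zero.1 h4 with h6 | h6
    · linarith
    · exact h6

/-- A function given by integrating a density against the Green function solves the radial ODE. -/
lemma IsRadialGreen.exists_ode {d : ℕ} {G f U : ℝ → ℝ} (hG : IsRadialGreen d G)
    (hf : ContinuousOn f (Icc 0 1))
    (hU : ∀ s ∈ Icc (0 : ℝ) 1, U s = ∫ r, f r * G (max r s) ∂radialMeasure d) :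
    ∃ P : ℝ → ℝ, (∀ s ∈ Ioo (0 : ℝ) 1, HasDerivAt U (P s) s) ∧
      (∀ s ∈ Ioo (0 : ℝ) 1, HasDerivAt P (-f s - d * P s / s) s) ∧
      Tendsto (fun s => P s / s) (𝓝[>] 0) (𝓝 (-f 0 / (d + 1))) ∧
      ∀ r ∈ Ioo (0 : ℝ) 1, ∫ t, (Iio r).indicator f t ∂radialMeasure d = -(r ^ d * P r) := by
  let g : ℝ → ℝ := IccExtend zero_le_one ((Icc (0 : ℝ) 1).domRestrict f)
  have hgc : Continuous g := hf.domRestrict.Icc_extend'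
  have hgf : ∀ s ∈ Icc (0 : ℝ) 1, g s = f s := fun s hs => by
    rw [show g s = _ from IccExtend_of_mem _ _ hs, domRestrict_apply]
  let F : ℝ → ℝ := fun s => ∫ t in (0 : ℝ)..s, t ^ d * g t
  have hFc : Continuous fun t => t ^ d * g t := by fun_prop
  have hF : ∀ s, HasDerivAt F (s ^ d * g s) s := fun s =>
    intervalIntegral.integral_hasDerivAt_right (hFc.intervalIntegrable _ _)
      (hFc.stronglyMeasurableAtFilter _ _) hFc.continuousAt
  have hGc := hG.continuousOn
  have hcont : ContinuousOn (fun t => t ^ d * g t * G t) (Ioi 0) := hFc.continuousOn.mul hGc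
  let J : ℝ → ℝ := fun s => ∫ t in s..(1 : ℝ), t ^ d * g t * G t
  have hII : ∀ s ∈ Ioo (0 : ℝ) 1, IntervalIntegrable (fun t => t ^ d * g t * G t) volume s 1 := by
    intro s hs
    refine (hcont.mono ?_).intervalIntegrable
    rw [uIcc_of_le hs.2.le]
    exact fun t ht => hs.1.trans_le ht.1
  have hJ : ∀ s ∈ Ioo (0 : ℝ) 1, HasDerivAt J (-(s ^ d * g s * G s)) s := fun s hs =>
    intervalIntegral.integral_hasDerivAt_left (hII s hs)
      (hcont.stronglyMeasurableAtFilter isOpen_Ioi s hs.1)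
      (hcont.continuousAt (Ioi_mem_nhds hs.1))
  have hUeq : ∀ s ∈ Ioo (0 : ℝ) 1, U s = G s * F s + J s := by
    intro s hs
    have i1 : IntervalIntegrable (fun t => t ^ d * g t * G (max t s)) volume 0 s := by
      refine ContinuousOn.intervalIntegrable (hFc.continuousOn.mul (hGc.comp (by fun_prop) ?_))
      exact fun t _ => lt_max_of_lt_right hs.1
    have i2 : IntervalIntegrable (fun t => t ^ d * g t * G (max t s)) volume s 1 := by
      refine ContinuousOn.intervalIntegrable (hFc.continuousOn.mul (hGc.comp (by fun_prop) ?_))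
      exact fun t _ => lt_max_of_lt_right hs.1
    rw [hU s (Ioo_subset_Icc_self hs), integral_radialMeasure, ← integral_Ioc_eq_integral_Ioo,
      ← intervalIntegral.integral_of_le zero_le_one]
    have e0 : ∫ t in (0 : ℝ)..1, t ^ d * (f t * G (max t s))
        = ∫ t in (0 : ℝ)..1, t ^ d * g t * G (max t s) := by
      refine intervalIntegral.integral_congr fun t ht => ?_
      rw [uIcc_of_le zero_le_one] at ht
      simp only [hgf t ht]
      ring
    rw [e0, ← intervalIntegral.integral_add_adjacent_intervals i1 i2]
    congr 1
    · rw [← intervalIntegral.integral_const_mul]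
      refine intervalIntegral.integral_congr fun t ht => ?_
      rw [uIcc_of_le hs.1.le] at ht
      simp only [max_eq_right ht.2]
      ring
    · refine intervalIntegral.integral_congr fun t ht => ?_
      rw [uIcc_of_le hs.2.le] at ht
      simp only [max_eq_left ht.1]
  refine ⟨fun s => -(F s / s ^ d), fun s hs => ?_, fun s hs => ?_, ?_, fun r hr => ?_⟩
  · have h1 := ((hG.hasDerivAt s hs.1).mul (hF s)).add (hJ s hs)
    have h2 : U =ᶠ[𝓝 s] fun s => G s * F s + J s := by
      filter_upwards [Ioo_mem_nhds hs.1 hs.2] with t ht using hUeq t ht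
    refine (h1.congr_of_eventuallyEq h2).congr_deriv ?_
    simp only [div_eq_mul_inv]
    ring
  · have hs0 : s ≠ 0 := hs.1.ne'
    have h1 := ((hF s).div (hasDerivAt_pow d s) (pow_ne_zero d hs0)).neg
    refine h1.congr_deriv ?_
    rw [hgf s (Ioo_subset_Icc_self hs)]
    rcases d with _ | d
    · simp
    · simp only [Nat.add_sub_cancel]
      field_simp
      ring
  · have h1 : Tendsto (fun s => F s / s ^ (d + 1)) (𝓝[>] 0) (𝓝 (f 0 / (d + 1))) := by
      refine HasDerivAt.lhopital_zero_nhdsGT (f' := fun s => s ^ d * g s)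
        (g' := fun s => ((d + 1 : ℕ) : ℝ) * s ^ d) (Eventually.of_forall hF)
        (Eventually.of_forall fun s => hasDerivAt_pow (d + 1) s) ?_ ?_ ?_ ?_
      · filter_upwards [self_mem_nhdsWithin] with s hs
        have : (0 : ℝ) < s := hs
        positivity
      · have : Tendsto F (𝓝 0) (𝓝 (F 0)) := (hF 0).continuousAt
        simp only [F, intervalIntegral.integral_same] at this
        exact this.mono_left nhdsWithin_le_nhds
      · have : Tendsto (fun s : ℝ => s ^ (d + 1)) (𝓝 0) (𝓝 (0 ^ (d + 1))) :=
          (continuous_pow (d + 1)).continuousAt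
        rw [zero_pow (by omega)] at this
        exact this.mono_left nhdsWithin_le_nhds
      · have h2 : Tendsto (fun s => g s / (d + 1)) (𝓝[>] 0) (𝓝 (g 0 / (d + 1))) :=
          ((hgc.tendsto 0).div_const _).mono_left nhdsWithin_le_nhds
        rw [hgf 0 (by simp)] at h2
        refine h2.congr' ?_
        filter_upwards [self_mem_nhdsWithin] with s hs
        have : (0 : ℝ) < s := hs
        push_cast
        field_simp
    have h3 := h1.neg
    rw [← neg_div] at h3
    refine h3.congr' ?_
    filter_upwards [self_mem_nhdsWithin] with s hs
    have : (0 : ℝ) < s := hs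
    rw [pow_succ]
    field_simp
  · have hr0 : r ^ d ≠ 0 := pow_ne_zero d hr.1.ne'
    rw [mul_neg, neg_neg, mul_div_cancel₀ _ hr0, integral_radialMeasure]
    have e1 : ∀ t, t ^ d * (Iio r).indicator f t = (Iio r).indicator (fun t => t ^ d * f t) t := by
      intro t
      by_cases h : t ∈ Iio r
      · simp [h]
      · simp [h]
    simp_rw [e1]
    rw [setIntegral_indicator measurableSet_Iio]
    have e2 : Ioo (0 : ℝ) 1 ∩ Iio r = Ioo 0 r := by
      ext t
      simp only [mem_inter_iff, mem_Ioo, mem_Iio]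
      exact ⟨fun h => ⟨h.1.1, h.2⟩, fun h => ⟨⟨h.1, h.2.trans hr.2⟩, h.2⟩⟩
    rw [e2, ← integral_Ioc_eq_integral_Ioo, ← intervalIntegral.integral_of_le hr.1.le]
    refine intervalIntegral.integral_congr fun t ht => ?_
    rw [uIcc_of_le hr.1.le] at ht
    simp only [hgf t ⟨ht.1, ht.2.trans hr.2.le⟩]

section RadialUniqueness

variable {d : ℕ} {U P q : ℝ → ℝ} {Q : ℝ}

lemma abs_two_mul_le_sq_add_sq (a b : ℝ) : |2 * a * b| ≤ a ^ 2 + b ^ 2 := by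
  rw [abs_le]
  constructor <;> nlinarith [sq_nonneg (a + b), sq_nonneg (a - b)]

lemma hasDerivAt_sq_add_sq {s : ℝ} (hU : HasDerivAt U (P s) s)
    (hP : HasDerivAt P (-(q s * U s) - d * P s / s) s) :
    HasDerivAt (fun s => U s ^ 2 + P s ^ 2)
      ((1 - q s) * (2 * U s * P s) - 2 * d * P s ^ 2 / s) s := by
  refine ((hU.pow 2).add (hP.pow 2)).congr_deriv ?_
  push_cast
  ring

/-- Vanishing Cauchy data at an interior radius propagates to smaller radii. -/
lemma radial_eq_zero_of_interior (hU : ∀ s ∈ Ioo (0 : ℝ) 1, HasDerivAt U (P s) s)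
    (hP : ∀ s ∈ Ioo (0 : ℝ) 1, HasDerivAt P (-(q s * U s) - d * P s / s) s)
    (hq : ∀ s ∈ Ioo (0 : ℝ) 1, |q s| ≤ Q) {r : ℝ} (hr : r ∈ Ioo (0 : ℝ) 1) (hUr : U r = 0)
    (hPr : P r = 0) {s : ℝ} (hs : s ∈ Ioc 0 r) : U s = 0 := by
  set C := 1 + Q + 2 * d / s with hC
  have hsub : Icc s r ⊆ Ioo 0 1 := fun t ht => ⟨hs.1.trans_le ht.1, ht.2.trans_lt hr.2⟩
  have hD : ∀ t ∈ Icc s r, HasDerivAt (fun t => Real.exp (C * t) * (U t ^ 2 + P t ^ 2))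
      (Real.exp (C * t) * (C * (U t ^ 2 + P t ^ 2) +
        ((1 - q t) * (2 * U t * P t) - 2 * d * P t ^ 2 / t))) t := by
    intro t ht
    have h1 := (((hasDerivAt_id t).const_mul C).exp).mul
      (hasDerivAt_sq_add_sq (hU t (hsub ht)) (hP t (hsub ht)))
    refine h1.congr_deriv ?_
    simp only [id_eq, mul_one]
    ring
  have hmono : MonotoneOn (fun t => Real.exp (C * t) * (U t ^ 2 + P t ^ 2)) (Icc s r) := by
    refine monotoneOn_of_deriv_nonneg (convex_Icc s r)
      (fun t ht => (hD t ht).continuousAt.continuousWithinAt)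
      (fun t ht => (hD t (interior_subset ht)).differentiableAt.differentiableWithinAt) ?_
    intro t ht
    have ht := interior_subset ht
    rw [(hD t ht).deriv]
    refine mul_nonneg (Real.exp_nonneg _) ?_
    have hq' := hq t (hsub ht)
    have h1 : |(1 - q t) * (2 * U t * P t)| ≤ (1 + Q) * (U t ^ 2 + P t ^ 2) := by
      rw [abs_mul]
      refine mul_le_mul ?_ (abs_two_mul_le_sq_add_sq _ _) (abs_nonneg _) ?_
      · calc |1 - q t| ≤ |1| + |q t| := abs_sub _ _
          _ ≤ 1 + Q := by rw [abs_one]; linarith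
      · linarith [(abs_nonneg _).trans hq']
    have h2 : 2 * d * P t ^ 2 / t ≤ 2 * d / s * (U t ^ 2 + P t ^ 2) := by
      calc 2 * d * P t ^ 2 / t ≤ 2 * d * P t ^ 2 / s := by
            gcongr
            · exact hs.1
            · exact ht.1
        _ = 2 * d / s * P t ^ 2 := by ring
        _ ≤ _ := by
          have := hs.1
          gcongr
          linarith [sq_nonneg (U t)]
    have h3 := (abs_le.1 h1).1
    rw [hC]
    linarith
  have h := hmono (left_mem_Icc.2 hs.2) (right_mem_Icc.2 hs.2) hs.2
  simp only [hUr, hPr] at h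
  have h' : U s ^ 2 + P s ^ 2 ≤ 0 := by
    have := Real.exp_pos (C * s)
    by_contra! hc
    have := mul_pos this hc
    norm_num at h
    linarith
  nlinarith [sq_nonneg (U s), sq_nonneg (P s)]

/-- A regular radial solution vanishing at the centre vanishes identically. -/
lemma radial_eq_zero_of_center (hU : ∀ s ∈ Ioo (0 : ℝ) 1, HasDerivAt U (P s) s)
    (hP : ∀ s ∈ Ioo (0 : ℝ) 1, HasDerivAt P (-(q s * U s) - d * P s / s) s)
    (hq : ∀ s ∈ Ioo (0 : ℝ) 1, |q s| ≤ Q) (hU0 : Tendsto U (𝓝[>] 0) (𝓝 0))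
    (hP0 : Tendsto P (𝓝[>] 0) (𝓝 0)) {s : ℝ} (hs : s ∈ Ioo (0 : ℝ) 1) : U s = 0 := by
  set C := 1 + Q with hC
  have hD : ∀ t ∈ Ioo (0 : ℝ) 1, HasDerivAt (fun t => Real.exp (-C * t) * (U t ^ 2 + P t ^ 2))
      (Real.exp (-C * t) * (-C * (U t ^ 2 + P t ^ 2) +
        ((1 - q t) * (2 * U t * P t) - 2 * d * P t ^ 2 / t))) t := by
    intro t ht
    have h1 := (((hasDerivAt_id t).const_mul (-C)).exp).mul
      (hasDerivAt_sq_add_sq (hU t ht) (hP t ht))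
    refine h1.congr_deriv ?_
    simp only [id_eq, mul_one]
    ring
  have hanti : AntitoneOn (fun t => Real.exp (-C * t) * (U t ^ 2 + P t ^ 2)) (Ioo 0 1) := by
    refine antitoneOn_of_deriv_nonpos (convex_Ioo 0 1)
      (fun t ht => (hD t ht).continuousAt.continuousWithinAt)
      (fun t ht => (hD t (interior_subset ht)).differentiableAt.differentiableWithinAt) ?_
    intro t ht
    have ht := interior_subset ht
    rw [(hD t ht).deriv]
    refine mul_nonpos_of_nonneg_of_nonpos (Real.exp_nonneg _) ?_
    have hq' := hq t ht
    have h1 : |(1 - q t) * (2 * U t * P t)| ≤ (1 + Q) * (U t ^ 2 + P t ^ 2) := by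
      rw [abs_mul]
      refine mul_le_mul ?_ (abs_two_mul_le_sq_add_sq _ _) (abs_nonneg _) ?_
      · calc |1 - q t| ≤ |1| + |q t| := abs_sub _ _
          _ ≤ 1 + Q := by rw [abs_one]; linarith
      · linarith [(abs_nonneg _).trans hq']
    have h2 : 0 ≤ 2 * d * P t ^ 2 / t := by
      have := ht.1
      positivity
    have h3 := (abs_le.1 h1).2
    rw [hC]
    linarith
  have hlim : Tendsto (fun t => Real.exp (-C * t) * (U t ^ 2 + P t ^ 2)) (𝓝[>] 0) (𝓝 0) := by
    have h1 : Tendsto (fun t => Real.exp (-C * t)) (𝓝[>] 0) (𝓝 (Real.exp (-C * 0))) :=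
      (Continuous.tendsto (by fun_prop) 0).mono_left nhdsWithin_le_nhds
    simpa using h1.mul ((hU0.pow 2).add (hP0.pow 2))
  have h : Real.exp (-C * s) * (U s ^ 2 + P s ^ 2) ≤ 0 := by
    refine ge_of_tendsto hlim ?_
    filter_upwards [Ioo_mem_nhdsGT hs.1] with t ht
    exact hanti ⟨ht.1, ht.2.trans hs.2⟩ hs ht.2.le
  have h' : U s ^ 2 + P s ^ 2 ≤ 0 := by
    have := Real.exp_pos (-C * s)
    by_contra! hc
    have := mul_pos this hc
    linarith
  nlinarith [sq_nonneg (U s), sq_nonneg (P s)]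

end RadialUniqueness

/-- The radial profile of a normalized positive solution. -/
lemma exists_radial_profile {d : ℕ} {p σ θ m : ℝ} {G W V : ℝ → ℝ} (hG : IsRadialGreen d G)
    (hp2 : 2 < p) (hp : p = 2 * θ + σ) (hθ : 0 < θ) (hθ1 : θ < 1) (hσ : 0 < σ) (hσ2 : σ < 2)
    (hW1 : ∀ r ∈ Ioo (0 : ℝ) 1, 1 ≤ W r)
    (hGW : ∀ r ∈ Ioo (0 : ℝ) 1, G r ≤ W r ^ 2)
    (hWp : Integrable (fun r => W r ^ (p + 1)) (radialMeasure d))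
    (hWσ : Integrable (fun r => W r ^ (σ / (1 - θ))) (radialMeasure d))
    (hVc : ContinuousOn V (Icc 0 1)) (hV0 : ∀ r ∈ Icc (0 : ℝ) 1, 0 < V r)
    (hV1 : ∀ r ∈ Icc (0 : ℝ) 1, V r ≤ 1) (hm : 0 < m) :
    ∃ (lam : ℝ) (U P : ℝ → ℝ), ContinuousOn U (Icc 0 1) ∧ U 1 = 0 ∧
      (∀ s ∈ Ico (0 : ℝ) 1, 0 < U s) ∧
      ∫ r in Ioo (0 : ℝ) 1, r ^ d * U r ^ 2 = m ∧
      (∀ s ∈ Ioo (0 : ℝ) 1, HasDerivAt U (P s) s) ∧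
      (∀ s ∈ Ioo (0 : ℝ) 1,
        HasDerivAt P (-(V s * U s ^ (p - 1) - lam * U s) - d * P s / s) s) ∧
      Tendsto (fun s => P s / s) (𝓝[>] 0)
        (𝓝 (-(V 0 * U 0 ^ (p - 1) - lam * U 0) / (d + 1))) := by
  obtain ⟨lam, U, hUc, hU1, hUm, hUG, hUz⟩ :=
    exists_integral_solution hG hp2 hp hθ hθ1 hσ hσ2 hW1 hGW hWp hWσ hVc hV0 hV1 hm
  rw [integral_radialMeasure] at hUm
  let q : ℝ → ℝ := fun r => V r * |U r| ^ (p - 2) - lam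
  have hqc : ContinuousOn q (Icc 0 1) :=
    (hVc.mul (hUc.abs.rpow_const fun _ _ => Or.inr (by linarith))).sub continuousOn_const
  obtain ⟨Q, hQ⟩ := isCompact_Icc.exists_bound_of_continuousOn hqc
  have hfq : ∀ r, V r * |U r| ^ (p - 2) * U r - lam * U r = q r * U r := fun r => by
    simp only [q]
    ring
  simp_rw [hfq] at hUG hUz
  obtain ⟨P, hUP, hP, hPlim, hPind⟩ := hG.exists_ode (f := fun r => q r * U r) (hqc.mul hUc) hUG
  have hQ' : ∀ s ∈ Ioo (0 : ℝ) 1, |q s| ≤ Q := fun s hs => hQ s (Ioo_subset_Icc_self hs)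
  have hUlim : Tendsto U (𝓝[>] 0) (𝓝 (U 0)) := by
    have h := hUc 0 (by simp)
    refine h.mono_left ?_
    rw [← nhdsWithin_Ioo_eq_nhdsGT zero_lt_one]
    exact nhdsWithin_mono _ Ioo_subset_Icc_self
  have hU0 : U 0 ≠ 0 := by
    intro h0
    have hP0 : Tendsto P (𝓝[>] 0) (𝓝 0) := by
      have h1 : Tendsto (fun s : ℝ => s) (𝓝[>] 0) (𝓝 0) := nhdsWithin_le_nhds
      have h2 := hPlim.mul h1
      rw [mul_zero] at h2
      refine h2.congr' ?_
      filter_upwards [self_mem_nhdsWithin] with s hs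
      exact div_mul_cancel₀ _ (ne_of_gt hs)
    rw [h0] at hUlim
    have hz : ∫ r in Ioo (0 : ℝ) 1, r ^ d * U r ^ 2 = 0 := by
      rw [setIntegral_congr_fun (g := fun _ => 0) measurableSet_Ioo]
      · simp
      · intro r hr
        simp [radial_eq_zero_of_center hUP hP hQ' hUlim hP0 hr]
    linarith
  have hUne : ∀ s ∈ Ico (0 : ℝ) 1, U s ≠ 0 := by
    intro s hs h0
    rcases hs.1.eq_or_lt with h | h
    · exact hU0 (h ▸ h0)
    have hs' : s ∈ Ioo (0 : ℝ) 1 := ⟨h, hs.2⟩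
    have hPs : P s = 0 := by
      have h1 := hPind s hs'
      rw [hUz s hs' h0, zero_eq_neg] at h1
      exact (mul_eq_zero.1 h1).resolve_left (pow_ne_zero d h.ne')
    refine hU0 (tendsto_nhds_unique hUlim ?_)
    refine tendsto_const_nhds.congr' ?_
    filter_upwards [Ioo_mem_nhdsGT h] with t ht
    exact (radial_eq_zero_of_interior hUP hP hQ' hs' h0 hPs ⟨ht.1, ht.2.le⟩).symm
  have hpow : ∀ t : ℝ, 0 < t → |t| ^ (p - 2) * t = t ^ (p - 1) := fun t ht => by
    rw [abs_of_pos ht, ← Real.rpow_add_one ht.ne']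
    ring_nf
  have key : ∀ (U P : ℝ → ℝ), ContinuousOn U (Icc 0 1) → U 1 = 0 →
      (∀ s ∈ Ico (0 : ℝ) 1, 0 < U s) → ∫ r in Ioo (0 : ℝ) 1, r ^ d * U r ^ 2 = m →
      (∀ s ∈ Ioo (0 : ℝ) 1, HasDerivAt U (P s) s) →
      (∀ s ∈ Ioo (0 : ℝ) 1,
        HasDerivAt P (-((V s * |U s| ^ (p - 2) - lam) * U s) - d * P s / s) s) →
      Tendsto (fun s => P s / s) (𝓝[>] 0)
        (𝓝 (-((V 0 * |U 0| ^ (p - 2) - lam) * U 0) / (d + 1))) → 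
      ∃ (lam : ℝ) (U P : ℝ → ℝ), ContinuousOn U (Icc 0 1) ∧ U 1 = 0 ∧
      (∀ s ∈ Ico (0 : ℝ) 1, 0 < U s) ∧
      ∫ r in Ioo (0 : ℝ) 1, r ^ d * U r ^ 2 = m ∧
      (∀ s ∈ Ioo (0 : ℝ) 1, HasDerivAt U (P s) s) ∧
      (∀ s ∈ Ioo (0 : ℝ) 1,
        HasDerivAt P (-(V s * U s ^ (p - 1) - lam * U s) - d * P s / s) s) ∧
      Tendsto (fun s => P s / s) (𝓝[>] 0)
        (𝓝 (-(V 0 * U 0 ^ (p - 1) - lam * U 0) / (d + 1))) := by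
    intro U P h1 h2 h3 h4 h5 h6 h7
    refine ⟨lam, U, P, h1, h2, h3, h4, h5, fun s hs => ?_, ?_⟩
    · rw [← hpow (U s) (h3 s ⟨hs.1.le, hs.2⟩), ← mul_assoc, ← sub_mul]
      exact h6 s hs
    · rw [← hpow (U 0) (h3 0 (by simp)), ← mul_assoc, ← sub_mul]
      exact h7
  have hsign : (∀ s ∈ Ico (0 : ℝ) 1, 0 < U s) ∨ ∀ s ∈ Ico (0 : ℝ) 1, U s < 0 := by
    have hc : IsPreconnected (U '' Ico 0 1) :=
      isPreconnected_Ico.image U (hUc.mono Ico_subset_Icc_self)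
    have h0 : (0 : ℝ) ∉ U '' Ico 0 1 := by
      rintro ⟨s, hs, hs0⟩
      exact hUne s hs hs0
    have hmem : ∀ s ∈ Ico (0 : ℝ) 1, U s ∈ U '' Ico 0 1 := fun s hs => mem_image_of_mem U hs
    have h00 : (0 : ℝ) ∈ Ico (0 : ℝ) 1 := by simp
    rcases lt_or_gt_of_ne hU0 with h | h
    · right
      intro s hs
      by_contra! hs'
      exact h0 (hc.ordConnected.out (hmem 0 h00) (hmem s hs) ⟨h.le, hs'⟩)
    · left
      intro s hs
      by_contra! hs'
      exact h0 (hc.ordConnected.out (hmem s hs) (hmem 0 h00) ⟨hs', h.le⟩)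
  rcases hsign with h | h
  · exact key U P hUc hU1 h hUm hUP hP hPlim
  · refine key (-U) (-P) hUc.neg (by simp [hU1]) (fun s hs => by simpa using h s hs)
      (by simpa using hUm) (fun s hs => (hUP s hs).neg) (fun s hs => ?_) ?_
    · refine (hP s hs).neg.congr_deriv ?_
      simp only [Pi.neg_apply, abs_neg, q]
      ring
    · have h1 := hPlim.neg
      convert! h1 using 2
      · simp [neg_div]
      · simp only [Pi.neg_apply, abs_neg, q]
        ring

section RadialFunction

lemma continuousAt_comp_norm_zero {F : Type*} [NormedAddCommGroup F] {g : ℝ → ℝ}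
    (h : Tendsto g (𝓝[>] 0) (𝓝 (g 0))) :
    ContinuousAt (fun y : F => g ‖y‖) 0 := by
  have h1 : ContinuousWithinAt g (Ici 0) 0 := by
    rw [← continuousWithinAt_Ioi_iff_Ici]
    exact h
  have h2 : Tendsto (fun y : F => ‖y‖) (𝓝 0) (𝓝[≥] 0) :=
    tendsto_nhdsWithin_iff.2 ⟨by simpa using (continuous_norm (E := F)).tendsto 0,
      Eventually.of_forall fun y => norm_nonneg y⟩
  have h3 := h1.tendsto.comp h2
  rw [ContinuousAt, norm_zero]
  exact h3

lemma norm_mem_Ioo_of_mem_ball {F : Type*} [NormedAddCommGroup F] {x : F}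
    (hx : x ∈ Metric.ball (0 : F) 1) (h0 : x ≠ 0) :
    ‖x‖ ∈ Ioo (0 : ℝ) 1 :=
  ⟨norm_pos_iff.2 h0, mem_ball_zero_iff.1 hx⟩

variable {E : Type*} [NormedAddCommGroup E] [InnerProductSpace ℝ E]

lemma hasFDerivAt_comp_norm {ψ : ℝ → ℝ} {c : ℝ} {x : E} (hx : x ≠ 0)
    (h : HasDerivAt ψ c ‖x‖) :
    HasFDerivAt (fun y : E => ψ ‖y‖) ((c / ‖x‖) • innerSL ℝ x) x := by
  have hn : 0 < ‖x‖ := norm_pos_iff.2 hx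
  have h1 : HasDerivAt (fun t => ψ √t) (c * (1 / (2 * √(‖x‖ ^ 2)))) (‖x‖ ^ 2) := by
    refine HasDerivAt.comp (h₂ := ψ) (‖x‖ ^ 2) ?_ (Real.hasDerivAt_sqrt (by positivity))
    rwa [Real.sqrt_sq hn.le]
  have h2 := h1.comp_hasFDerivAt x (hasStrictFDerivAt_norm_sq x).hasFDerivAt
  have h3 : (fun y : E => ψ ‖y‖) = (fun t => ψ √t) ∘ fun y : E => ‖y‖ ^ 2 := by
    ext y
    simp [Real.sqrt_sq (norm_nonneg y)]
  rw [h3]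
  refine h2.congr_fderiv ?_
  rw [Real.sqrt_sq hn.le]
  ext y
  simp
  field_simp

/-- `ψ` is the profile of a radial `C²` function on the unit ball, with `ψ' = r A` and
`r A' = b`. -/
structure IsRadialProfile (ψ A b : ℝ → ℝ) : Prop where
  deriv_fun : ∀ r ∈ Ioo (0 : ℝ) 1, HasDerivAt ψ (r * A r) r
  deriv_slope : ∀ r ∈ Ioo (0 : ℝ) 1, HasDerivAt A (b r / r) r
  continuousOn : ContinuousOn b (Ioo 0 1)
  map_zero : b 0 = 0
  tendsto_fun : Tendsto ψ (𝓝[>] 0) (𝓝 (ψ 0))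
  tendsto_slope : Tendsto A (𝓝[>] 0) (𝓝 (A 0))
  tendsto_zero : Tendsto b (𝓝[>] 0) (𝓝 0)

namespace IsRadialProfile

variable {ψ A b : ℝ → ℝ}

lemma hasFDerivAt (h : IsRadialProfile ψ A b) {x : E} (hx : x ∈ Metric.ball (0 : E) 1) :
    HasFDerivAt (fun y : E => ψ ‖y‖) (innerSL ℝ (A ‖x‖ • x)) x := by
  rcases eq_or_ne x 0 with rfl | h0
  · have hlim : Tendsto (fun r => r * A r) (𝓝[>] 0) (𝓝 0) := by
      have h1 : Tendsto (fun s : ℝ => s) (𝓝[>] 0) (𝓝 0) := nhdsWithin_le_nhds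
      simpa using h1.mul h.tendsto_slope
    have hd : HasDerivWithinAt ψ 0 (Ici 0) 0 := by
      refine hasDerivWithinAt_Ici_of_tendsto_deriv (s := Ioo 0 1)
        (fun r hr => (h.deriv_fun r hr).differentiableAt.differentiableWithinAt)
        (h.tendsto_fun.mono_left (nhdsWithin_mono _ fun r hr => hr.1))
        (Ioo_mem_nhdsGT zero_lt_one) (hlim.congr' ?_)
      filter_upwards [Ioo_mem_nhdsGT zero_lt_one] with r hr using (h.deriv_fun r hr).deriv.symm
    have h2 : Tendsto (fun y : E => ‖y‖) (𝓝 0) (𝓝[≥] 0) :=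
      tendsto_nhdsWithin_iff.2 ⟨by simpa using (continuous_norm (E := E)).tendsto 0,
        Eventually.of_forall fun y => norm_nonneg y⟩
    rw [hasFDerivAt_iff_isLittleO]
    have h3 := (hasDerivWithinAt_iff_isLittleO.1 hd).comp_tendsto h2
    simp only [Function.comp_def, sub_zero, smul_zero] at h3
    simpa using h3.of_norm_right
  · have hn := norm_mem_Ioo_of_mem_ball hx h0
    refine (hasFDerivAt_comp_norm h0 (h.deriv_fun _ hn)).congr_fderiv ?_
    rw [mul_div_cancel_left₀ _ hn.1.ne']
    ext y
    simp

/-- The derivative of the gradient field `x ↦ A ‖x‖ • x`. -/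
lemma hasFDerivAt_gradient (h : IsRadialProfile ψ A b) {x : E}
    (hx : x ∈ Metric.ball (0 : E) 1) :
    HasFDerivAt (fun y : E => A ‖y‖ • y) (A ‖x‖ • ContinuousLinearMap.id ℝ E +
      (b ‖x‖ / ‖x‖ ^ 2) • InnerProductSpace.rankOne ℝ x x) x := by
  rcases eq_or_ne x 0 with rfl | h0
  · have h1 := continuousAt_comp_norm_zero (F := E) h.tendsto_slope
    rw [hasFDerivAt_iff_isLittleO]
    have h2 : (fun y : E => A ‖y‖ - A 0) =o[𝓝 0] fun _ => (1 : ℝ) := by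
      rw [Asymptotics.isLittleO_one_iff]
      have := h1.tendsto
      rw [norm_zero] at this
      simpa using this.sub_const (A 0)
    have h3 := h2.smul_isBigO (Asymptotics.isBigO_refl (fun y : E => y) (𝓝 0))
    simpa [sub_smul] using h3
  · have hn := norm_mem_Ioo_of_mem_ball hx h0
    have h1 := (hasFDerivAt_comp_norm h0 (h.deriv_slope _ hn)).smul (hasFDerivAt_id x)
    refine h1.congr_fderiv ?_
    ext y
    simp [smul_smul, sq, div_div]

lemma continuousOn_fderiv_gradient (h : IsRadialProfile ψ A b) :
    ContinuousOn (fun x : E => A ‖x‖ • ContinuousLinearMap.id ℝ E +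
      (b ‖x‖ / ‖x‖ ^ 2) • InnerProductSpace.rankOne ℝ x x) (Metric.ball 0 1) := by
  have hcr : Continuous fun x : E => InnerProductSpace.rankOne ℝ x x :=
    (InnerProductSpace.rankOne ℝ).continuous.clm_apply continuous_id
  intro x hx
  refine ContinuousAt.continuousWithinAt (ContinuousAt.add (ContinuousAt.fun_smul ?_
    continuousAt_const) ?_)
  · rcases eq_or_ne x 0 with rfl | h0
    · exact continuousAt_comp_norm_zero h.tendsto_slope
    · exact ContinuousAt.comp (h.deriv_slope _ (norm_mem_Ioo_of_mem_ball hx h0)).continuousAt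
        continuous_norm.continuousAt
  · rcases eq_or_ne x 0 with rfl | h0
    · have h1 : ContinuousAt (fun y : E => b ‖y‖) 0 :=
        continuousAt_comp_norm_zero (by rw [h.map_zero]; exact h.tendsto_zero)
      have h2 : Tendsto (fun y : E => |b ‖y‖|) (𝓝 0) (𝓝 0) := by
        simpa [h.map_zero] using h1.tendsto.abs
      rw [ContinuousAt, norm_zero, h.map_zero]
      simp only [zero_div, zero_smul]
      refine squeeze_zero_norm (fun y => ?_) h2
      rw [norm_smul, InnerProductSpace.norm_rankOne, norm_div, Real.norm_eq_abs,
        norm_pow, norm_norm, ← sq]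
      rcases eq_or_ne ‖y‖ 0 with hy | hy
      · simp [hy]
      · rw [div_mul_cancel₀ _ (pow_ne_zero 2 hy)]
    · have hn := norm_mem_Ioo_of_mem_ball hx h0
      refine ContinuousAt.smul (f := fun y : E => b ‖y‖ / ‖y‖ ^ 2) (ContinuousAt.div ?_
        (continuous_norm.pow 2).continuousAt ?_) hcr.continuousAt
      · exact ContinuousAt.comp (h.continuousOn.continuousAt (Ioo_mem_nhds hn.1 hn.2))
          continuous_norm.continuousAt
      · exact pow_ne_zero 2 hn.1.ne'

lemma contDiffOn_gradient (h : IsRadialProfile ψ A b) :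
    ContDiffOn ℝ 1 (fun y : E => A ‖y‖ • y) (Metric.ball 0 1) := by
  rw [show (1 : WithTop ℕ∞) = 0 + 1 from rfl,
    contDiffOn_succ_iff_hasFDerivWithinAt_of_uniqueDiffOn Metric.isOpen_ball.uniqueDiffOn]
  exact ⟨by simp, _, contDiffOn_zero.2 h.continuousOn_fderiv_gradient,
    fun x hx => (h.hasFDerivAt_gradient hx).hasFDerivWithinAt⟩

lemma contDiffOn [FiniteDimensional ℝ E] (h : IsRadialProfile ψ A b) :
    ContDiffOn ℝ 2 (fun y : E => ψ ‖y‖) (Metric.ball 0 1) := by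
  rw [show (2 : WithTop ℕ∞) = 1 + 1 from rfl,
    contDiffOn_succ_iff_hasFDerivWithinAt_of_uniqueDiffOn Metric.isOpen_ball.uniqueDiffOn]
  refine ⟨by simp, _, ?_, fun x hx => (h.hasFDerivAt hx).hasFDerivWithinAt⟩
  rw [contDiffOn_clm_apply]
  intro y
  exact h.contDiffOn_gradient.inner ℝ contDiffOn_const

lemma lap_eq {N : ℕ} (h : IsRadialProfile ψ A b) {x : Euc N}
    (hx : x ∈ Metric.ball (0 : Euc N) 1) :
    lap (fun y : Euc N => ψ ‖y‖) x = N * A ‖x‖ + b ‖x‖ := by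
  have h1 : ∀ i : Fin N, fderiv ℝ (fun y => fderiv ℝ (fun y : Euc N => ψ ‖y‖) y
      (EuclideanSpace.single i 1)) x (EuclideanSpace.single i 1)
      = A ‖x‖ + b ‖x‖ / ‖x‖ ^ 2 * x i ^ 2 := by
    intro i
    have h2 : (fun y => fderiv ℝ (fun y : Euc N => ψ ‖y‖) y (EuclideanSpace.single i 1))
        =ᶠ[𝓝 x] fun y => (A ‖y‖ • y) i := by
      filter_upwards [Metric.isOpen_ball.mem_nhds hx] with y hy
      rw [(h.hasFDerivAt hy).fderiv]
      simp [EuclideanSpace.inner_single_right]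
    have h3 := (EuclideanSpace.proj (𝕜 := ℝ) i).hasFDerivAt.comp x (h.hasFDerivAt_gradient hx)
    rw [h2.fderiv_eq]
    have h4 : fderiv ℝ (fun y : Euc N => (A ‖y‖ • y) i) x = _ := HasFDerivAt.fderiv h3
    rw [h4]
    simp [EuclideanSpace.inner_single_right]
    left
    ring
  rw [lap, Finset.sum_congr rfl fun i _ => h1 i, Finset.sum_add_distrib, ← Finset.mul_sum,
    ← EuclideanSpace.real_norm_sq_eq]
  simp only [Finset.sum_const, Finset.card_univ, Fintype.card_fin, nsmul_eq_mul]
  rcases eq_or_ne ‖x‖ 0 with h0 | h0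
  · simp [h0, h.map_zero]
  · rw [div_mul_cancel₀ _ (pow_ne_zero 2 h0)]

end IsRadialProfile

end RadialFunction

section FirstEigenvalue

variable {N : ℕ}

lemma sum_sq_apply_single_le (L : Euc N →L[ℝ] ℝ) :
    ∑ i, L (EuclideanSpace.single i 1) ^ 2 ≤ ‖L‖ ^ 2 := by
  obtain ⟨y, rfl⟩ := (InnerProductSpace.toDual ℝ (Euc N)).surjective L
  rw [LinearIsometryEquiv.norm_map, EuclideanSpace.real_norm_sq_eq]
  simp [EuclideanSpace.inner_single_right]

lemma support_sq_subset {α : Type*} (f : α → ℝ) :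
    Function.support (fun x => f x ^ 2) ⊆ Function.support f :=
  fun x hx h => hx (by simp [h])

lemma integrable_of_continuousOn_of_support_subset {Ω : Set (Euc N)} {F φ : Euc N → ℝ}
    (hΩ : IsOpen Ω) (hφ : HasCompactSupport φ) (hφΩ : tsupport φ ⊆ Ω) (hF : ContinuousOn F Ω)
    (hFφ : Function.support F ⊆ tsupport φ) : Integrable F := by
  have h1 : tsupport F ⊆ tsupport φ := closure_minimal hFφ (isClosed_tsupport φ)
  have h2 : Continuous F := continuous_of_tsupport fun x hx =>
    hF.continuousAt (hΩ.mem_nhds (hφΩ (h1 hx)))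
  exact h2.integrable_of_hasCompactSupport (hφ.mono' hFφ)

/-- Picone's inequality: a positive supersolution bounds the Rayleigh quotient from below. -/
lemma mul_integral_sq_le_of_supersolution {Ω : Set (Euc N)} {w φ : Euc N → ℝ} {κ : ℝ}
    (hΩ : IsOpen Ω) (hw : ContDiffOn ℝ 2 w Ω) (hpos : ∀ x ∈ Ω, 0 < w x)
    (hsup : ∀ x ∈ Ω, κ * w x ≤ -lap w x) (hφ : ContDiff ℝ 1 φ) (hφc : HasCompactSupport φ)
    (hφΩ : tsupport φ ⊆ Ω) :
    κ * ∫ x, φ x ^ 2 ≤ ∫ x, ‖fderiv ℝ φ x‖ ^ 2 := by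
  let e : Fin N → Euc N := fun i => EuclideanSpace.single i 1
  let f : Euc N → ℝ := fun x => φ x ^ 2 / w x
  let g : Fin N → Euc N → ℝ := fun i x => fderiv ℝ w x (e i)
  have hf : ContDiffOn ℝ 1 f Ω :=
    (hφ.contDiffOn.pow 2).div (hw.of_le (by norm_num)) fun x hx => (hpos x hx).ne'
  have hg : ∀ i, ContDiffOn ℝ 1 (g i) Ω := fun i =>
    (hw.fderiv_of_isOpen hΩ (by norm_num)).clm_apply contDiffOn_const
  have hfc : ∀ i, ContinuousOn (fun x => fderiv ℝ f x (e i)) Ω := fun i =>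
    (hf.continuousOn_fderiv_of_isOpen hΩ le_rfl).clm_apply continuousOn_const
  have hgc : ∀ i, ContinuousOn (fun x => fderiv ℝ (g i) x (e i)) Ω := fun i =>
    ((hg i).continuousOn_fderiv_of_isOpen hΩ le_rfl).clm_apply continuousOn_const
  have hφe : ∀ i, Continuous (fun x => fderiv ℝ φ x (e i)) := fun i =>
    (hφ.continuous_fderiv (by norm_num)).clm_apply continuous_const
  have hsf : Function.support f ⊆ tsupport φ := by
    intro x hx
    refine subset_tsupport φ fun h => hx ?_
    simp [f, h]
  have htf : tsupport f ⊆ tsupport φ := closure_minimal hsf (isClosed_tsupport φ)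
  have hsf' : ∀ i, Function.support (fun x => fderiv ℝ f x (e i)) ⊆ tsupport φ := fun i =>
    (subset_tsupport _).trans ((tsupport_fderiv_apply_subset ℝ (e i)).trans htf)
  have hsφ : ∀ i, Function.support (fun x => fderiv ℝ φ x (e i)) ⊆ tsupport φ := fun i =>
    (subset_tsupport _).trans (tsupport_fderiv_apply_subset ℝ (e i))
  have i1 : ∀ i, Integrable fun x => fderiv ℝ f x (e i) * g i x := fun i =>
    integrable_of_continuousOn_of_support_subset hΩ hφc hφΩ ((hfc i).mul (hg i).continuousOn)
      ((Function.support_mul_subset_left _ _).trans (hsf' i))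
  have i2 : ∀ i, Integrable fun x => f x * fderiv ℝ (g i) x (e i) := fun i =>
    integrable_of_continuousOn_of_support_subset hΩ hφc hφΩ (hf.continuousOn.mul (hgc i))
      ((Function.support_mul_subset_left _ _).trans hsf)
  have i3 : ∀ i, Integrable fun x => f x * g i x := fun i =>
    integrable_of_continuousOn_of_support_subset hΩ hφc hφΩ
      (hf.continuousOn.mul (hg i).continuousOn)
      ((Function.support_mul_subset_left _ _).trans hsf)
  have i4 : ∀ i, Integrable fun x => fderiv ℝ φ x (e i) ^ 2 := fun i =>
    integrable_of_continuousOn_of_support_subset hΩ hφc hφΩ ((hφe i).pow 2).continuousOn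
      ((support_sq_subset _).trans (hsφ i))
  have i5 : Integrable fun x => φ x ^ 2 :=
    integrable_of_continuousOn_of_support_subset hΩ hφc hφΩ (hφ.continuous.pow 2).continuousOn
      ((support_sq_subset _).trans (subset_tsupport φ))
  have i6 : Integrable fun x => ‖fderiv ℝ φ x‖ ^ 2 :=
    integrable_of_continuousOn_of_support_subset hΩ hφc hφΩ
      ((hφ.continuous_fderiv (by norm_num)).norm.pow 2).continuousOn
      ((support_sq_subset _).trans
        (fun x hx => support_fderiv_subset ℝ fun h => hx (norm_eq_zero.2 h)))
  have hdf : ∀ x, DifferentiableAt ℝ f x := by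
    intro x
    by_cases hx : x ∈ Ω
    · exact (hf.contDiffAt (hΩ.mem_nhds hx)).differentiableAt (by norm_num)
    · have h1 : f =ᶠ[𝓝 x] 0 := notMem_tsupport_iff_eventuallyEq.1 fun h => hx (hφΩ (htf h))
      exact (differentiableAt_const (0 : ℝ)).congr_of_eventuallyEq h1
  have hparts : ∀ i, ∫ x, f x * fderiv ℝ (g i) x (e i) = -∫ x, fderiv ℝ f x (e i) * g i x :=
    fun i => integral_mul_fderiv_eq_neg_fderiv_mul_of_integrable (i1 i) (i2 i) (i3 i)
      (fun x _ => hdf x) fun x hx =>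
        ((hg i).contDiffAt (hΩ.mem_nhds (hφΩ (htf hx)))).differentiableAt (by norm_num)
  have hpicone : ∀ i x, fderiv ℝ f x (e i) * g i x ≤ fderiv ℝ φ x (e i) ^ 2 := by
    intro i x
    by_cases hx : x ∈ Ω
    · have hwx := hpos x hx
      have h1 : HasFDerivAt w (fderiv ℝ w x) x :=
        ((hw.contDiffAt (hΩ.mem_nhds hx)).differentiableAt (by norm_num)).hasFDerivAt
      have h2 : HasFDerivAt φ (fderiv ℝ φ x) x :=
        (hφ.differentiable (by norm_num)).differentiableAt.hasFDerivAt
      have h3 : HasFDerivAt (fun y => φ y ^ 2 * (w y)⁻¹) _ x :=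
        (h2.pow 2).mul ((hasDerivAt_inv hwx.ne').comp_hasFDerivAt x h1)
      have h4 : fderiv ℝ f x (e i) = 2 * φ x * fderiv ℝ φ x (e i) / w x
          - φ x ^ 2 * fderiv ℝ w x (e i) / w x ^ 2 := by
        have h5 : f = fun y => φ y ^ 2 * (w y)⁻¹ := by
          ext y
          simp [f, div_eq_mul_inv]
        rw [h5, h3.fderiv]
        simp
        field_simp
        ring
      rw [h4]
      simp only [g]
      set a := fderiv ℝ φ x (e i)
      set b := fderiv ℝ w x (e i)
      have h6 : (2 * φ x * a / w x - φ x ^ 2 * b / w x ^ 2) * b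
          = a ^ 2 - (a - φ x * b / w x) ^ 2 := by
        field_simp
        ring
      nlinarith [sq_nonneg (a - φ x * b / w x)]
    · have : fderiv ℝ f x (e i) = 0 := by
        by_contra h
        exact hx (hφΩ (hsf' i h))
      rw [this, zero_mul]
      positivity
  calc κ * ∫ x, φ x ^ 2 = ∫ x, κ * φ x ^ 2 := (integral_const_mul _ _).symm
    _ ≤ ∫ x, -∑ i, f x * fderiv ℝ (g i) x (e i) := by
      refine integral_mono (i5.const_mul κ) (integrable_finsetSum _ fun i _ => i2 i).neg
        fun x => ?_
      by_cases hx : x ∈ Ω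
      · have hwx := hpos x hx
        have h1 := mul_le_mul_of_nonneg_left (hsup x hx)
          (div_nonneg (sq_nonneg (φ x)) hwx.le)
        have h2 : φ x ^ 2 / w x * (κ * w x) = κ * φ x ^ 2 := by field_simp
        rw [h2] at h1
        simp only [← Finset.mul_sum]
        refine h1.trans (le_of_eq ?_)
        rw [mul_neg]
        rfl
      · have h1 : φ x = 0 := by
          by_contra h
          exact hx (hφΩ (subset_tsupport φ h))
        simp [f, h1]
    _ = ∑ i, ∫ x, fderiv ℝ f x (e i) * g i x := by
      rw [integral_neg, integral_finsetSum _ fun i _ => i2 i, ← Finset.sum_neg_distrib]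
      refine Finset.sum_congr rfl fun i _ => ?_
      rw [hparts, neg_neg]
    _ ≤ ∑ i, ∫ x, fderiv ℝ φ x (e i) ^ 2 :=
      Finset.sum_le_sum fun i _ => integral_mono (i1 i) (i4 i) (hpicone i)
    _ = ∫ x, ∑ i, fderiv ℝ φ x (e i) ^ 2 := (integral_finsetSum _ fun i _ => i4 i).symm
    _ ≤ ∫ x, ‖fderiv ℝ φ x‖ ^ 2 :=
      integral_mono (integrable_finsetSum _ fun i _ => i4 i) i6
        fun x => sum_sq_apply_single_le _

/-- Barta's inequality on the unit ball. -/
lemma le_firstEig_of_supersolution {w : Euc N → ℝ} {κ : ℝ}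
    (hw : ContDiffOn ℝ 2 w (Metric.ball 0 1)) (hpos : ∀ x ∈ Metric.ball (0 : Euc N) 1, 0 < w x)
    (hsup : ∀ x ∈ Metric.ball (0 : Euc N) 1, κ * w x ≤ -lap w x) :
    κ ≤ firstEig (Metric.ball (0 : Euc N) 1) := by
  refine le_csInf ?_ ?_
  · let β : ContDiffBump (0 : Euc N) := ⟨1 / 4, 1 / 2, by norm_num, by norm_num⟩
    refine ⟨_, β, β.contDiff, β.hasCompactSupport, ?_, ?_, rfl⟩
    · rw [β.tsupport_eq]
      exact Metric.closedBall_subset_ball (by norm_num [β])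
    · intro h
      have h1 := β.one_of_mem_closedBall (Metric.mem_closedBall_self β.rIn_pos.le)
      rw [h] at h1
      simp at h1
  · rintro r ⟨φ, hφ, hφc, hφΩ, hφ0, rfl⟩
    have h1 := mul_integral_sq_le_of_supersolution Metric.isOpen_ball hw hpos hsup
      (hφ.of_le (by simp)) hφc hφΩ
    obtain ⟨x, hx⟩ := Function.ne_iff.1 hφ0
    have h2 : 0 < ∫ x, φ x ^ 2 := by
      refine (hφ.continuous.pow 2).integral_pos_of_hasCompactSupport_nonneg_nonzero
        (x := x) ?_ (fun x => sq_nonneg _) (pow_ne_zero 2 hx)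
      exact hφc.mono (support_sq_subset φ)
    rwa [le_div_iff₀ h2]

end FirstEigenvalue

/-- A perturbation of a positive function by a multiple of the torsion function satisfies a
strict differential inequality. -/
lemma exists_strict_perturbation {Φ h U : ℝ → ℝ} (lam : ℝ) (hΦ : ContinuousOn Φ (Icc 0 1))
    (hh : ContinuousOn h (Icc 0 1)) (hU : ContinuousOn U (Icc 0 1))
    (hΦ0 : ∀ r ∈ Icc (0 : ℝ) 1, 0 ≤ Φ r) (hΦpos : ∀ r ∈ Ico (0 : ℝ) 1, 0 < Φ r)
    (hh1 : h 1 = 0) :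
    ∃ η δ : ℝ, 0 < η ∧ 0 < δ ∧
      ∀ r ∈ Icc (0 : ℝ) 1, δ * (U r + η * h r) ≤ Φ r + η * (1 + lam * h r) := by
  obtain ⟨C, hC⟩ := isCompact_Icc.exists_bound_of_continuousOn
    (f := fun r => 1 + lam * h r) (continuousOn_const.add (continuousOn_const.mul hh))
  set K : Set ℝ := Icc 0 1 ∩ (fun r => 1 + lam * h r) ⁻¹' Iic 0 with hK
  have hKc : IsCompact K := isCompact_Icc.of_isClosed_subset
    ((continuousOn_const.add (continuousOn_const.mul hh)).preimage_isClosed_of_isClosed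
      isClosed_Icc isClosed_Iic) inter_subset_left
  obtain ⟨m', hm', hKm⟩ := hKc.exists_forall_le' (hΦ.mono inter_subset_left) (a := 0) (by
    intro r hr
    refine hΦpos r ⟨hr.1.1, lt_of_le_of_ne hr.1.2 ?_⟩
    rintro rfl
    have := hr.2
    simp [hh1] at this
    linarith)
  set η := m' / (2 * (|C| + 1)) with hη
  have hη0 : 0 < η := by positivity
  have hηC : η * (|C| + 1) = m' / 2 := by
    rw [hη]
    field_simp
  have hpos : ∀ r ∈ Icc (0 : ℝ) 1, 0 < Φ r + η * (1 + lam * h r) := by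
    intro r hr
    by_cases hrK : r ∈ K
    · have h1 := hKm r hrK
      have h2 := (abs_le.1 ((hC r hr).trans (le_abs_self C))).1
      nlinarith
    · have h1 : 0 < 1 + lam * h r := by
        by_contra! h1
        exact hrK ⟨hr, h1⟩
      have := hΦ0 r hr
      positivity
  have hc : ContinuousOn (fun r => Φ r + η * (1 + lam * h r)) (Icc 0 1) :=
    hΦ.add (continuousOn_const.mul (continuousOn_const.add (continuousOn_const.mul hh)))
  obtain ⟨ε, hε, hεle⟩ := isCompact_Icc.exists_forall_le' hc hpos
  obtain ⟨M, hM⟩ := isCompact_Icc.exists_bound_of_continuousOn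
    (f := fun r => U r + η * h r) (hU.add (continuousOn_const.mul hh))
  refine ⟨η, ε / (|M| + 1), hη0, by positivity, fun r hr => ?_⟩
  refine le_trans ?_ (hεle r hr)
  have h1 : U r + η * h r ≤ |M| + 1 := by
    have := (le_abs_self _).trans ((hM r hr).trans (le_abs_self M))
    linarith
  calc ε / (|M| + 1) * (U r + η * h r) ≤ ε / (|M| + 1) * (|M| + 1) := by gcongr
    _ = ε := by field_simp

section PowerBound

lemma integrable_rpow_radialMeasure {d : ℕ} {β q C : ℝ} (hC : 0 ≤ C) (h : β * q < d + 1) :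
    Integrable (fun r => (C * r ^ (-β)) ^ q) (radialMeasure d) := by
  rw [integrable_radialMeasure_iff]
  have h1 : IntegrableOn (fun r : ℝ => r ^ ((d : ℝ) - β * q)) (Ioo 0 1) :=
    (intervalIntegral.integrableOn_Ioo_rpow_iff one_pos).2 (by linarith)
  refine IntegrableOn.congr_fun (h1.const_mul (C ^ q)) (fun r hr => ?_) measurableSet_Ioo
  have hr0 : 0 < r := hr.1
  rw [Real.mul_rpow hC (by positivity), ← Real.rpow_mul hr0.le, sub_eq_add_neg,
    Real.rpow_add hr0, Real.rpow_natCast, ← neg_mul]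
  ring

/-- The radial profile of a normalized positive solution, when the square root of the Green
function is dominated by a power. -/
lemma exists_radial_profile_of_le_rpow {d : ℕ} {p β C m : ℝ} {G V : ℝ → ℝ}
    (hG : IsRadialGreen d G) (hp2 : 2 < p) (hβ : 0 ≤ β) (hC : 1 ≤ C)
    (hβp : β * (p + 1) < d + 1) (hβp' : 4 * β < (d + 1) * (4 - p))
    (hGW : ∀ r ∈ Ioo (0 : ℝ) 1, G r ≤ (C * r ^ (-β)) ^ 2)
    (hVc : ContinuousOn V (Icc 0 1)) (hV0 : ∀ r ∈ Icc (0 : ℝ) 1, 0 < V r)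
    (hV1 : ∀ r ∈ Icc (0 : ℝ) 1, V r ≤ 1) (hm : 0 < m) :
    ∃ (lam : ℝ) (U P : ℝ → ℝ), ContinuousOn U (Icc 0 1) ∧ U 1 = 0 ∧
      (∀ s ∈ Ico (0 : ℝ) 1, 0 < U s) ∧
      ∫ r in Ioo (0 : ℝ) 1, r ^ d * U r ^ 2 = m ∧
      (∀ s ∈ Ioo (0 : ℝ) 1, HasDerivAt U (P s) s) ∧
      (∀ s ∈ Ioo (0 : ℝ) 1,
        HasDerivAt P (-(V s * U s ^ (p - 1) - lam * U s) - d * P s / s) s) ∧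
      Tendsto (fun s => P s / s) (𝓝[>] 0)
        (𝓝 (-(V 0 * U 0 ^ (p - 1) - lam * U 0) / (d + 1))) := by
  set ε := ((d + 1) * (4 - p) - 4 * β) / (2 * (d + 1)) with hε
  have hd : (0 : ℝ) < d + 1 := by positivity
  have hε2 : 2 * ((d + 1) * ε) = (d + 1) * (4 - p) - 4 * β := by
    rw [hε]
    field_simp
  have hε0 : 0 < ε := by
    have : 0 < (d + 1) * ε := by linarith
    exact pos_of_mul_pos_right this hd.le
  have hε4 : 2 * ε ≤ 4 - p := by
    refine le_of_mul_le_mul_left ?_ hd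
    linarith
  have hθ : 0 < 1 - (p - (2 - ε)) / 2 := by linarith
  refine exists_radial_profile (σ := 2 - ε) (θ := (p - (2 - ε)) / 2)
    (W := fun r => C * r ^ (-β)) hG hp2 (by ring) (by linarith) (by linarith) (by linarith)
    (by linarith) (fun r hr => ?_) hGW
    (integrable_rpow_radialMeasure (by linarith) hβp)
    (integrable_rpow_radialMeasure (by linarith) ?_) hVc hV0 hV1 hm
  · exact one_le_mul_of_one_le_of_one_le hC
      (Real.one_le_rpow_of_pos_of_le_one_of_nonpos hr.1 hr.2.le (by linarith))
  · rw [← mul_div_assoc, div_lt_iff₀ hθ]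
    have : 0 < (d + 1) * ε := by positivity
    have : 0 ≤ β * ε := by positivity
    linarith

lemma isRadialGreen_neg_log : IsRadialGreen 1 (fun r => -Real.log r) where
  hasDerivAt r hr := by simpa using (Real.hasDerivAt_log hr.ne').fun_neg
  map_one := by simp

lemma isRadialGreen_inv_sub_one : IsRadialGreen 2 (fun r => r⁻¹ - 1) where
  hasDerivAt r hr := by simpa using (hasDerivAt_inv hr.ne').sub_const 1
  map_one := by simp

lemma neg_log_le_rpow_sq {β r : ℝ} (hβ : 0 < β) (hr : 0 < r) :
    -Real.log r ≤ ((1 + 1 / (2 * β)) * r ^ (-β)) ^ 2 := by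
  have h1 := Real.log_le_rpow_div (inv_pos.2 hr).le (mul_pos two_pos hβ)
  rw [Real.log_inv, Real.inv_rpow hr.le, ← Real.rpow_neg hr.le] at h1
  have h2 : r ^ (-(2 * β)) = (r ^ (-β)) ^ 2 := by
    rw [← Real.rpow_natCast, ← Real.rpow_mul hr.le]
    congr 1
    push_cast
    ring
  rw [h2] at h1
  refine h1.trans ?_
  rw [mul_pow, mul_comm, div_eq_mul_one_div, mul_comm]
  gcongr
  have : 0 < 1 / (2 * β) := by positivity
  nlinarith

/-- The radial profile of a normalized positive solution in dimensions two and three, in the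
mass-subcritical range. -/
lemma exists_radial_profile_of_subcritical {d : ℕ} {p m : ℝ} {V : ℝ → ℝ} (hp2 : 2 < p)
    (hd : (d = 1 ∧ p < 4) ∨ (d = 2 ∧ p < 10 / 3))
    (hVc : ContinuousOn V (Icc 0 1)) (hV0 : ∀ r ∈ Icc (0 : ℝ) 1, 0 < V r)
    (hV1 : ∀ r ∈ Icc (0 : ℝ) 1, V r ≤ 1) (hm : 0 < m) :
    ∃ (lam : ℝ) (U P : ℝ → ℝ), ContinuousOn U (Icc 0 1) ∧ U 1 = 0 ∧
      (∀ s ∈ Ico (0 : ℝ) 1, 0 < U s) ∧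
      ∫ r in Ioo (0 : ℝ) 1, r ^ d * U r ^ 2 = m ∧
      (∀ s ∈ Ioo (0 : ℝ) 1, HasDerivAt U (P s) s) ∧
      (∀ s ∈ Ioo (0 : ℝ) 1,
        HasDerivAt P (-(V s * U s ^ (p - 1) - lam * U s) - d * P s / s) s) ∧
      Tendsto (fun s => P s / s) (𝓝[>] 0)
        (𝓝 (-(V 0 * U 0 ^ (p - 1) - lam * U 0) / (d + 1))) := by
  rcases hd with ⟨rfl, hp⟩ | ⟨rfl, hp⟩
  · have hβ : 0 < (4 - p) / 4 := by linarith
    refine exists_radial_profile_of_le_rpow (β := (4 - p) / 4)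
      (C := 1 + 1 / (2 * ((4 - p) / 4))) isRadialGreen_neg_log hp2 hβ.le ?_ ?_ ?_
      (fun r hr => neg_log_le_rpow_sq hβ hr.1) hVc hV0 hV1 hm
    · have : 0 < 1 / (2 * ((4 - p) / 4)) := by positivity
      linarith
    · norm_num
      nlinarith [sq_nonneg (p - 2)]
    · norm_num
      linarith
  · refine exists_radial_profile_of_le_rpow (β := 1 / 2) (C := 1) isRadialGreen_inv_sub_one hp2
      (by norm_num) le_rfl ?_ ?_ (fun r hr => ?_) hVc hV0 hV1 hm
    · norm_num
      linarith
    · norm_num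
      linarith
    · have h1 : (1 * r ^ (-(1 / 2) : ℝ)) ^ 2 = r⁻¹ := by
        rw [one_mul, ← Real.rpow_natCast, ← Real.rpow_mul hr.1.le, ← Real.rpow_neg_one]
        norm_num
      rw [h1]
      linarith

end PowerBound

section Assembly

lemma IsRadialProfile.of_radial_ode {d : ℕ} {U P f : ℝ → ℝ} (hU : ContinuousOn U (Icc 0 1))
    (hf : ContinuousOn f (Icc 0 1)) (hU' : ∀ r ∈ Ioo (0 : ℝ) 1, HasDerivAt U (P r) r)
    (hP' : ∀ r ∈ Ioo (0 : ℝ) 1, HasDerivAt P (-f r - d * P r / r) r)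
    (hlim : Tendsto (fun r => P r / r) (𝓝[>] 0) (𝓝 (-f 0 / (d + 1)))) :
    ∃ A b : ℝ → ℝ, IsRadialProfile U A b ∧ ∀ r, (d + 1) * A r + b r = -f r := by
  have hd : (0 : ℝ) < d + 1 := by positivity
  let A : ℝ → ℝ := fun r => if r = 0 then -f 0 / (d + 1) else P r / r
  have hA : ∀ r, r ≠ 0 → A r = P r / r := fun r hr => if_neg hr
  have hA0 : A 0 = -f 0 / (d + 1) := if_pos rfl
  have hpos : ∀ᶠ r : ℝ in 𝓝[>] 0, r ∈ Ioo (0 : ℝ) 1 := Ioo_mem_nhdsGT one_pos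
  have hcont : ∀ {g : ℝ → ℝ}, ContinuousOn g (Icc 0 1) → Tendsto g (𝓝[>] 0) (𝓝 (g 0)) := by
    intro g hg
    refine (hg 0 (by simp)).tendsto.mono_left ?_
    rw [← nhdsWithin_Ioo_eq_nhdsGT one_pos]
    exact nhdsWithin_mono 0 Ioo_subset_Icc_self
  have hAlim : Tendsto A (𝓝[>] 0) (𝓝 (A 0)) := by
    rw [hA0]
    refine hlim.congr' ?_
    filter_upwards [hpos] with r hr
    rw [hA r hr.1.ne']
  have hAd : ∀ r ∈ Ioo (0 : ℝ) 1, HasDerivAt A ((-f r - (d + 1) * A r) / r) r := by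
    intro r hr
    have hr0 : r ≠ 0 := hr.1.ne'
    have h1 := (hP' r hr).fun_div (hasDerivAt_id r) hr0
    refine (h1.congr_of_eventuallyEq ?_).congr_deriv ?_
    · filter_upwards [eventually_ne_nhds hr0] with x hx
      rw [hA x hx, id]
    · rw [hA r hr0]
      simp only [id]
      field_simp
      ring
  refine ⟨A, fun r => -f r - (d + 1) * A r, ⟨?_, hAd, ?_, ?_, hcont hU, hAlim, ?_⟩,
    fun r => by ring⟩
  · intro r hr
    have hr0 : r ≠ 0 := hr.1.ne'
    rw [hA r hr0, mul_div_cancel₀ _ hr0]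
    exact hU' r hr
  · exact (hf.mono Ioo_subset_Icc_self).neg.sub (continuousOn_const.mul fun r hr =>
      (hAd r hr).continuousAt.continuousWithinAt)
  · simp only [hA0]
    field_simp
    ring
  · have h1 := (hcont hf).neg.sub (hAlim.const_mul ((d : ℝ) + 1))
    convert h1 using 2
    rw [hA0]
    field_simp
    ring

lemma IsRadialProfile.add_torsion {ψ A b : ℝ → ℝ} (h : IsRadialProfile ψ A b) (c : ℝ) :
    IsRadialProfile (fun r => ψ r + c * (1 - r ^ 2)) (fun r => A r - 2 * c) b where
  deriv_fun r hr := by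
    refine ((h.deriv_fun r hr).add
      (((hasDerivAt_pow 2 r).const_sub 1).const_mul c)).congr_deriv ?_
    norm_num
    ring
  deriv_slope r hr := (h.deriv_slope r hr).sub_const _
  continuousOn := h.continuousOn
  map_zero := h.map_zero
  tendsto_fun := by
    have h1 : Continuous fun r : ℝ => c * (1 - r ^ 2) := by fun_prop
    exact h.tendsto_fun.add (h1.tendsto 0 |>.mono_left nhdsWithin_le_nhds)
  tendsto_slope := h.tendsto_slope.sub_const _
  tendsto_zero := h.tendsto_zero

/-- A radial solution with positive nonlinearity forces `-λ` to lie strictly below the first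
eigenvalue. -/
lemma neg_firstEig_lt_of_radial {N : ℕ} (hN : N ≠ 0) {U A b Φ : ℝ → ℝ} {lam : ℝ}
    (hU : ContinuousOn U (Icc 0 1)) (hUpos : ∀ r ∈ Ico (0 : ℝ) 1, 0 < U r)
    (hΦ : ContinuousOn Φ (Icc 0 1)) (hΦ0 : ∀ r ∈ Icc (0 : ℝ) 1, 0 ≤ Φ r)
    (hΦpos : ∀ r ∈ Ico (0 : ℝ) 1, 0 < Φ r) (h : IsRadialProfile U A b)
    (heq : ∀ r, N * A r + b r = -(Φ r - lam * U r)) :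
    -firstEig (Metric.ball (0 : Euc N) 1) < lam := by
  have hN0 : (0 : ℝ) < N := by positivity
  let τ : ℝ → ℝ := fun r => 1 / (2 * N) * (1 - r ^ 2)
  obtain ⟨η, δ, hη, hδ, hstrict⟩ := exists_strict_perturbation (h := τ) lam hΦ
    (by fun_prop) hU hΦ0 hΦpos (by simp [τ])
  have h1 := h.add_torsion (η * (1 / (2 * N)))
  have hmem : ∀ x ∈ Metric.ball (0 : Euc N) 1, ‖x‖ ∈ Ico (0 : ℝ) 1 := fun x hx =>
    ⟨norm_nonneg x, mem_ball_zero_iff.1 hx⟩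
  have hle : δ - lam ≤ firstEig (Metric.ball (0 : Euc N) 1) := by
    refine le_firstEig_of_supersolution h1.contDiffOn (fun x hx => ?_) fun x hx => ?_
    · have h2 := hUpos _ (hmem x hx)
      have h3 : ‖x‖ ^ 2 ≤ 1 := pow_le_one₀ (norm_nonneg x) (hmem x hx).2.le
      have h4 : 0 ≤ η * (1 / (2 * N)) * (1 - ‖x‖ ^ 2) :=
        mul_nonneg (by positivity) (by linarith)
      linarith
    · rw [h1.lap_eq hx]
      have h2 := hstrict ‖x‖ (Ico_subset_Icc_self (hmem x hx))
      have h3 := heq ‖x‖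
      have h4 : (N : ℝ) * (2 * (η * (1 / (2 * N)))) = η := by field_simp
      simp only [τ] at h2
      linarith
  linarith

lemma integral_ball_comp_norm_sq {d : ℕ} (U : ℝ → ℝ) :
    ∫ x in Metric.ball (0 : Euc (d + 1)) 1, U ‖x‖ ^ 2
      = (d + 1) * volume.real (Metric.ball (0 : Euc (d + 1)) 1) *
        ∫ r in Ioo (0 : ℝ) 1, r ^ d * U r ^ 2 := by
  have h1 := integral_fun_norm_addHaar (volume : Measure (Euc (d + 1)))
    ((Iio (1 : ℝ)).indicator fun r => U r ^ 2)
  have h2 : (fun x : Euc (d + 1) => (Iio (1 : ℝ)).indicator (fun r => U r ^ 2) ‖x‖)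
      = (Metric.ball (0 : Euc (d + 1)) 1).indicator fun x => U ‖x‖ ^ 2 := by
    ext x
    simp [indicator]
  rw [h2, integral_indicator measurableSet_ball] at h1
  rw [h1]
  have h3 : ∀ r : ℝ, r ^ (Module.finrank ℝ (Euc (d + 1)) - 1) •
      (Iio (1 : ℝ)).indicator (fun r => U r ^ 2) r
      = (Iio (1 : ℝ)).indicator (fun r => r ^ d * U r ^ 2) r := by
    intro r
    simp [indicator]
  simp only [h3]
  rw [setIntegral_indicator measurableSet_Iio, Ioi_inter_Iio]
  simp [mul_assoc]

/-- Normalized positive radial solutions on the unit ball for a positive bounded weight. -/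
lemma exists_radial_solution {d : ℕ} {p c : ℝ} {V : ℝ → ℝ} (hp2 : 2 < p)
    (hd : (d = 1 ∧ p < 4) ∨ (d = 2 ∧ p < 10 / 3))
    (hVc : ContinuousOn V (Icc 0 1)) (hV0 : ∀ r ∈ Icc (0 : ℝ) 1, 0 < V r)
    (hV1 : ∀ r ∈ Icc (0 : ℝ) 1, V r ≤ 1) (hc : 0 < c) :
    ∃ (lam : ℝ) (u : Euc (d + 1) → ℝ), -firstEig (Metric.ball (0 : Euc (d + 1)) 1) < lam ∧
      IsPosSolution (Metric.ball (0 : Euc (d + 1)) 1) (fun x t => V ‖x‖ * t ^ (p - 1)) lam u ∧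
      ∫ x in Metric.ball (0 : Euc (d + 1)) 1, u x ^ 2 = c := by
  have hvol : 0 < (d + 1) * volume.real (Metric.ball (0 : Euc (d + 1)) 1) :=
    mul_pos (by positivity) (ENNReal.toReal_pos
      (Metric.measure_ball_pos _ _ one_pos).ne' measure_ball_lt_top.ne)
  obtain ⟨lam, U, P, hUc, hU1, hUpos, hUm, hU', hP', hlim⟩ :=
    exists_radial_profile_of_subcritical hp2 hd hVc hV0 hV1 (div_pos hc hvol)
  have hΦc : ContinuousOn (fun r => V r * U r ^ (p - 1)) (Icc 0 1) :=
    hVc.mul (hUc.rpow_const fun _ _ => Or.inr (by linarith))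
  have hUnonneg : ∀ r ∈ Icc (0 : ℝ) 1, 0 ≤ U r := by
    intro r hr
    rcases hr.2.lt_or_eq with h | rfl
    · exact (hUpos r ⟨hr.1, h⟩).le
    · exact hU1.ge
  obtain ⟨A, b, hprof, heq⟩ := IsRadialProfile.of_radial_ode
    (f := fun r => V r * U r ^ (p - 1) - lam * U r) hUc
    (hΦc.sub (continuousOn_const.mul hUc)) hU' hP' hlim
  refine ⟨lam, fun x => U ‖x‖, ?_, ⟨hprof.contDiffOn, ?_, ?_, ?_, ?_⟩, ?_⟩
  · refine neg_firstEig_lt_of_radial d.succ_ne_zero hUc hUpos hΦc (fun r hr => ?_)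
      (fun r hr => ?_) hprof (by exact_mod_cast heq)
    · have := hV0 r hr
      have := hUnonneg r hr
      positivity
    · have := hV0 r (Ico_subset_Icc_self hr)
      have := hUpos r hr
      positivity
  · rw [closure_ball _ one_ne_zero]
    exact hUc.comp continuous_norm.continuousOn fun x hx =>
      ⟨norm_nonneg x, mem_closedBall_zero_iff.1 hx⟩
  · exact fun x hx => hUpos _ ⟨norm_nonneg x, mem_ball_zero_iff.1 hx⟩
  · intro x hx
    rw [frontier_ball _ one_ne_zero, mem_sphere_zero_iff_norm] at hx
    simp only [hx, hU1]
  · intro x hx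
    rw [hprof.lap_eq hx]
    have := heq ‖x‖
    push_cast
    linarith
  · rw [integral_ball_comp_norm_sq, hUm, mul_div_cancel₀ _ hvol.ne']

end Assembly

/-- for `-Δu + λu = (1+|x|^k)^{-s} u^{p-1}` on the unit ball, in the
mass-subcritical cases (`N = 2`, `2 < p < 4`, `2ks ≤ 6 - p`) or (`N = 3`,
`2 < p < 10/3`, `ks ≤ 4 - p`), every mass `c ∈ (0, ∞)` is attained by a
positive solution. -/
theorem statement17 {N : ℕ} (hN : 2 ≤ N) {s k p : ℝ} (hs : 1 < s) (hk : 0 ≤ k)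
    (hp2 : 2 < p) (hpcrit : 3 ≤ N → p < 2 * N / ((N : ℝ) - 2))
    (hcase : (N = 2 ∧ 2 < p ∧ p < 4 ∧ 2 * k * s ≤ 6 - p) ∨
      (N = 3 ∧ 2 < p ∧ p < 10 / 3 ∧ k * s ≤ 4 - p)) :
    ∀ c : ℝ, 0 < c →
      ∃ (lam : ℝ) (u : Euc N → ℝ), - firstEig (Metric.ball (0 : Euc N) 1) < lam ∧
        IsPosSolution (Metric.ball (0 : Euc N) 1) (fker N k s p) lam u ∧
        (∫ x in Metric.ball (0 : Euc N) 1, (u x) ^ 2) = c := by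
  intro c hc
  have hbase : ∀ r ∈ Icc (0 : ℝ) 1, 1 ≤ 1 + r ^ k := fun r hr =>
    le_add_of_nonneg_right (Real.rpow_nonneg hr.1 k)
  have hVc : ContinuousOn (fun r : ℝ => (1 + r ^ k) ^ (-s)) (Icc 0 1) :=
    (continuousOn_const.add (continuousOn_id.rpow_const fun _ _ => Or.inr hk)).rpow_const
      fun r hr => Or.inl (zero_lt_one.trans_le (hbase r hr)).ne'
  have hV0 : ∀ r ∈ Icc (0 : ℝ) 1, 0 < (1 + r ^ k) ^ (-s) := fun r hr =>
    Real.rpow_pos_of_pos (zero_lt_one.trans_le (hbase r hr)) _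
  have hV1 : ∀ r ∈ Icc (0 : ℝ) 1, (1 + r ^ k) ^ (-s) ≤ 1 := fun r hr =>
    Real.rpow_le_one_of_one_le_of_nonpos (hbase r hr) (by linarith)
  rcases hcase with ⟨rfl, -, hp, -⟩ | ⟨rfl, -, hp, -⟩
  · exact exists_radial_solution (d := 1) hp2 (Or.inl ⟨rfl, hp⟩) hVc hV0 hV1 hc
  · exact exists_radial_solution (d := 2) hp2 (Or.inr ⟨rfl, hp⟩) hVc hV0 hV1 hc
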